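/- Let γ>1, 0<r₀<r₁, 𝓜={x∈ℝ³ : r₀<|x|<r₁}, and let p₀>0, A₁>0, E₁∈ℝ satisfy E₁ > (γ/(γ−1))·A₁^{1/γ}·p₀^{(γ−1)/γ} and p₀ > ((2/γ)·((γ−1)/(γ+1)))^{γ/(γ−1)}·E₁^{γ/(γ−1)}·A₁^{−1/(γ−1)}. Suppose ρ,p:cl(𝓜)→ℝ and u:cl(𝓜)→ℝ³ are twice continuously differentiable in 𝓜 and continuously differentiable on cl(𝓜), solve the steady compressible Euler system with b=0 and r=0 in 𝓜, satisfy ρ(x)>0 and u(x)·x>0 for all x∈cl(𝓜), and satisfy the boundary conditions: p(x)=p₀ for |x|=r₀; and for |x|=r₁: u(x)×x=0, |u(x)|²/2+γp(x)/((γ−1)ρ(x))=E₁, and p(x)ρ(x)^{−γ}=A₁. Then the solution is spherically symmetric with purely radial velocity: there exist functions ũ,ρ̃,p̃:[r₀,r₁]→ℝ such that u(x)=ũ(|x|)·x/|x|, ρ(x)=ρ̃(|x|), p(x)=p̃(|x|) for all x∈cl(𝓜); moreover (ũ,ρ̃,p̃) solves the radial ODE system and is subsonic, i.e. 0<ũ(t)<√(γp̃(t)/ρ̃(t))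 for all t∈[r₀,r₁]. -/

import Mathlib

open scoped BigOperators

/-- Euclidean norm on `Fin 3 → ℝ`. -/
noncomputable def enorm3 (x : Fin 3 → ℝ) : ℝ := Real.sqrt (∑ i, (x i) ^ 2)

/-- Partial derivative `∂ⱼ f` at `x`. -/
noncomputable def pd (j : Fin 3) (f : (Fin 3 → ℝ) → ℝ) (x : Fin 3 → ℝ) : ℝ :=
  fderiv ℝ f x (Pi.single j 1)

/-- The steady compressible Euler system (momentum, mass, energy) with adiabatic
exponent `γ`, force `b` and heat supply `r`, on the set `Ω`. -/
noncomputable def SteadyEuler (γ : ℝ) (Ω : Set (Fin 3 → ℝ))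
    (ρ p : (Fin 3 → ℝ) → ℝ) (u b : (Fin 3 → ℝ) → Fin 3 → ℝ)
    (r : (Fin 3 → ℝ) → ℝ) : Prop :=
  ∀ x ∈ Ω,
    (∀ i, (∑ j, pd j (fun y => ρ y * u y i * u y j) x) + pd i p x = ρ x * b x i) ∧
    (∑ j, pd j (fun y => ρ y * u y j) x) = 0 ∧
    (∑ j, pd j (fun y => ρ y * ((∑ i, (u y i) ^ 2) / 2 + γ * p y / ((γ - 1) * ρ y)) * u y j) x)
      = ρ x * (∑ i, b x i * u x i) + ρ x * r x

/-- The radial ODE system of spherically symmetric steady Euler flow on `[r₀, r₁]`. -/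
def RadialEuler (γ r₀ r₁ : ℝ) (u ρ p : ℝ → ℝ) : Prop :=
  ∀ r ∈ Set.Icc r₀ r₁,
    HasDerivWithinAt u
      (2 * (γ * p r / ρ r) * u r / (r * ((u r) ^ 2 - γ * p r / ρ r)))
      (Set.Icc r₀ r₁) r ∧
    HasDerivWithinAt ρ
      (-(2 * ρ r * (u r) ^ 2) / (r * ((u r) ^ 2 - γ * p r / ρ r)))
      (Set.Icc r₀ r₁) r ∧
    HasDerivWithinAt p
      (-(2 * ρ r * (γ * p r / ρ r) * (u r) ^ 2) / (r * ((u r) ^ 2 - γ * p r / ρ r)))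
      (Set.Icc r₀ r₁) r

theorem enorm3_nonneg (x : Fin 3 → ℝ) : 0 ≤ enorm3 x := Real.sqrt_nonneg _

theorem enorm3_sq (x : Fin 3 → ℝ) : enorm3 x ^ 2 = ∑ i, (x i) ^ 2 :=
  Real.sq_sqrt (Finset.sum_nonneg fun i _ => sq_nonneg (x i))

theorem continuous_enorm3 : Continuous enorm3 := by
  unfold enorm3
  fun_prop

theorem enorm3_smul (a : ℝ) (x : Fin 3 → ℝ) : enorm3 (a • x) = |a| * enorm3 x := by
  rw [enorm3, enorm3, ← Real.sqrt_sq_eq_abs, ← Real.sqrt_mul (sq_nonneg a), Finset.mul_sum]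
  simp [mul_pow]

theorem enorm3_eq_norm_toLp (x : Fin 3 → ℝ) : enorm3 x = ‖WithLp.toLp 2 x‖ := by
  simp [EuclideanSpace.norm_eq, enorm3]

theorem convexOn_enorm3 : ConvexOn ℝ Set.univ enorm3 := by
  have h := (convexOn_univ_norm (E := EuclideanSpace ℝ (Fin 3))).comp_linearMap
    (WithLp.linearEquiv 2 ℝ (Fin 3 → ℝ)).symm.toLinearMap
  have he : enorm3 = norm ∘ (WithLp.linearEquiv 2 ℝ (Fin 3 → ℝ)).symm.toLinearMap := by
    funext x
    exact enorm3_eq_norm_toLp x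
  rw [he]
  simpa using h

theorem isCompact_shell (a b : ℝ) : IsCompact {x | a ≤ enorm3 x ∧ enorm3 x ≤ b} := by
  refine Metric.isCompact_of_isClosed_isBounded ?_ ?_
  · exact (isClosed_le continuous_const continuous_enorm3).inter
      (isClosed_le continuous_enorm3 continuous_const)
  · refine (Metric.isBounded_closedBall (x := (0 : Fin 3 → ℝ)) (r := |b|)).subset ?_
    rintro x ⟨-, hx⟩
    rw [mem_closedBall_zero_iff, pi_norm_le_iff_of_nonneg (abs_nonneg b)]
    intro i
    refine le_trans ?_ (hx.trans (le_abs_self b))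
    rw [Real.norm_eq_abs]
    refine Real.abs_le_sqrt ?_
    exact Finset.single_le_sum (f := fun i => (x i) ^ 2) (fun i _ => sq_nonneg (x i))
      (Finset.mem_univ i)

theorem isOpen_openShell (a b : ℝ) : IsOpen {x | a < enorm3 x ∧ enorm3 x < b} :=
  (isOpen_lt continuous_const continuous_enorm3).inter
    (isOpen_lt continuous_enorm3 continuous_const)

theorem uniqueDiffOn_halfOpenShell (a b : ℝ) (hb : 0 < b) :
    UniqueDiffOn ℝ {x | a < enorm3 x ∧ enorm3 x ≤ b} := by
  have hc : UniqueDiffOn ℝ {x | enorm3 x ≤ b} := by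
    refine uniqueDiffOn_convex ?_ ⟨0, ?_⟩
    · simpa using convexOn_enorm3.convex_le b
    · refine mem_interior.2 ⟨{x | enorm3 x < b}, fun x hx => (show enorm3 x < b from hx).le,
        isOpen_lt continuous_enorm3 continuous_const, ?_⟩
      simpa [enorm3] using hb
  have := hc.inter (isOpen_lt continuous_const continuous_enorm3 : IsOpen {x | a < enorm3 x})
  rwa [Set.inter_comm] at this

/-- The Euclidean inner product on `Fin 3 → ℝ` as a continuous bilinear form. -/
noncomputable def dot3 : (Fin 3 → ℝ) →L[ℝ] (Fin 3 → ℝ) →L[ℝ] ℝ :=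
  ∑ i, (ContinuousLinearMap.proj i : (Fin 3 → ℝ) →L[ℝ] ℝ).smulRight
    (ContinuousLinearMap.proj i : (Fin 3 → ℝ) →L[ℝ] ℝ)

theorem dot3_apply (x y : Fin 3 → ℝ) : dot3 x y = ∑ i, x i * y i := by
  simp [dot3]

theorem hasFDerivAt_enorm3 {x : Fin 3 → ℝ} (hx : enorm3 x ≠ 0) :
    HasFDerivAt enorm3 ((enorm3 x)⁻¹ • dot3 x) x := by
  have h1 : HasFDerivAt (fun y : Fin 3 → ℝ => ∑ i, (y i) ^ 2) ((2 : ℝ) • dot3 x) x := by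
    have h : ∀ i ∈ Finset.univ, HasFDerivAt (fun y : Fin 3 → ℝ => (y i) ^ 2)
        ((2 * x i) • (ContinuousLinearMap.proj i : (Fin 3 → ℝ) →L[ℝ] ℝ)) x := by
      intro i _
      have := (hasFDerivAt_apply (𝕜 := ℝ) i x).pow 2
      simpa using this
    refine (HasFDerivAt.fun_sum h).congr_fderiv ?_
    ext v
    simp [dot3_apply, Finset.mul_sum, mul_assoc]
  have h2 : ∑ i, (x i) ^ 2 ≠ 0 := by
    rw [← enorm3_sq]
    exact pow_ne_zero 2 hx
  refine (h1.sqrt h2).congr_fderiv ?_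
  ext v
  change 1 / (2 * enorm3 x) * (2 * dot3 x v) = (enorm3 x)⁻¹ * dot3 x v
  field_simp

theorem HasDerivAt.enorm3_comp {c : ℝ → Fin 3 → ℝ} {c' : Fin 3 → ℝ} {t : ℝ}
    (hc : HasDerivAt c c' t) (h : enorm3 (c t) ≠ 0) :
    HasDerivAt (fun s => enorm3 (c s)) ((enorm3 (c t))⁻¹ * dot3 (c t) c') t :=
  (hasFDerivAt_enorm3 h).comp_hasDerivAt t hc

theorem HasDerivAt.eventually_lt_nhdsGT {f : ℝ → ℝ} {a x : ℝ} (hf : HasDerivAt f a x)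
    (ha : 0 < a) : ∀ᶠ t in nhdsWithin x (Set.Ioi x), f x < f t := by
  have h := (hasDerivAt_iff_tendsto_slope.1 hf).mono_left
    (nhdsWithin_mono x (fun t (ht : x < t) => ht.ne'))
  filter_upwards [h.eventually (lt_mem_nhds ha), self_mem_nhdsWithin] with t ht hxt
  rw [slope_def_field, div_pos_iff_of_pos_right (sub_pos.2 hxt)] at ht
  exact sub_pos.1 ht

theorem sum_mul_pd (f : (Fin 3 → ℝ) → ℝ) (x v : Fin 3 → ℝ) :
    ∑ j, v j * pd j f x = fderiv ℝ f x v := by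
  conv_rhs => rw [pi_eq_sum_univ' v]
  simp only [map_sum, map_smul, smul_eq_mul, pd]

/-- A function transported by a field pointing outwards is determined by its values on the
outer sphere. -/
theorem eq_of_transport {r₀ r₁ c : ℝ} {f : (Fin 3 → ℝ) → ℝ} {u : (Fin 3 → ℝ) → Fin 3 → ℝ}
    (hf : ContinuousOn f {x | r₀ < enorm3 x ∧ enorm3 x ≤ r₁})
    (hd : ∀ x, r₀ < enorm3 x → enorm3 x < r₁ → DifferentiableAt ℝ f x)
    (ht : ∀ x, r₀ < enorm3 x → enorm3 x < r₁ → fderiv ℝ f x (u x) = 0)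
    (hu : ∀ x, r₀ < enorm3 x → enorm3 x < r₁ → 0 < ∑ i, u x i * x i)
    (hb : ∀ x, enorm3 x = r₁ → f x = c) :
    ∀ x, r₀ < enorm3 x → enorm3 x ≤ r₁ → f x = c := by
  have upper : ∀ (g : (Fin 3 → ℝ) → ℝ) (c : ℝ),
      ContinuousOn g {x | r₀ < enorm3 x ∧ enorm3 x ≤ r₁} →
      (∀ x, r₀ < enorm3 x → enorm3 x < r₁ → DifferentiableAt ℝ g x) →
      (∀ x, r₀ < enorm3 x → enorm3 x < r₁ → fderiv ℝ g x (u x) = 0) →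
      (∀ x, enorm3 x = r₁ → g x = c) → ∀ x, r₀ < enorm3 x → enorm3 x ≤ r₁ → g x ≤ c := by
    intro g c hg hgd hgt hgb x hx0 hx1
    have hε : ∀ ε : ℝ, 0 < ε → g x ≤ c + ε * r₁ ^ 2 := by
      intro ε hε
      set h : (Fin 3 → ℝ) → ℝ := fun y => g y + ε * ∑ i, (y i) ^ 2 with hh
      have hsub : {y | enorm3 x ≤ enorm3 y ∧ enorm3 y ≤ r₁} ⊆
          {y | r₀ < enorm3 y ∧ enorm3 y ≤ r₁} := fun y hy => ⟨hx0.trans_le hy.1, hy.2⟩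
      have hhc : ContinuousOn h {y | r₀ < enorm3 y ∧ enorm3 y ≤ r₁} :=
        hg.add (by fun_prop)
      obtain ⟨z, hz, hmax⟩ := (isCompact_shell (enorm3 x) r₁).exists_isMaxOn
        ⟨x, le_refl _, hx1⟩ (hhc.mono hsub)
      have hzx := hmax (show x ∈ {y | enorm3 x ≤ enorm3 y ∧ enorm3 y ≤ r₁} from ⟨le_rfl, hx1⟩)
      simp only [Set.mem_ofPred_eq] at hzx
      rcases hz.2.eq_or_lt with hzr | hzr
      · have : h z = c + ε * r₁ ^ 2 := by
          simp only [hh, hgb z hzr, ← enorm3_sq, hzr]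
        have hx : g x ≤ h x := by
          simp only [hh]
          have : 0 ≤ ∑ i, (x i) ^ 2 := Finset.sum_nonneg fun i _ => sq_nonneg _
          nlinarith
        linarith
      · exfalso
        have hz0 : r₀ < enorm3 z := hx0.trans_le hz.1
        have hupos := hu z hz0 hzr
        have hzne : enorm3 z ≠ 0 := by
          intro h0
          have h2 := enorm3_sq z
          rw [h0] at h2
          have h3 : ∀ i, z i = 0 := by
            intro i
            have := Finset.sum_eq_zero_iff_of_nonneg (s := Finset.univ)
              (f := fun i => (z i) ^ 2) (fun i _ => sq_nonneg (z i))
            have h4 := this.1 (by simpa using h2.symm) i (Finset.mem_univ i)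
            exact pow_eq_zero_iff two_ne_zero |>.1 h4
          simp [h3] at hupos
        have hc : HasDerivAt (fun t : ℝ => z + t • u z) (u z) 0 := by
          simpa using ((hasDerivAt_id (0 : ℝ)).smul_const (u z)).const_add z
        have hgl : HasDerivAt (fun t : ℝ => g (z + t • u z)) 0 0 := by
          have h1 : HasFDerivAt g (fderiv ℝ g z) (z + (0 : ℝ) • u z) := by
            simpa using (hgd z hz0 hzr).hasFDerivAt
          exact (h1.comp_hasDerivAt (0 : ℝ) hc).congr_deriv (hgt z hz0 hzr)
        have hnl : HasDerivAt (fun t : ℝ => enorm3 (z + t • u z))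
            ((enorm3 z)⁻¹ * dot3 z (u z)) 0 := by
          simpa using hc.enorm3_comp (by simpa using hzne)
        have hpos : 0 < (enorm3 z)⁻¹ * dot3 z (u z) := by
          refine mul_pos (inv_pos.2 (lt_of_le_of_ne (enorm3_nonneg z) hzne.symm)) ?_
          rw [dot3_apply]
          simpa [mul_comm] using hupos
        have hhl : HasDerivAt (fun t : ℝ => h (z + t • u z))
            (ε * (2 * enorm3 z * ((enorm3 z)⁻¹ * dot3 z (u z)))) 0 := by
          have h1 := hgl.add ((hnl.pow 2).const_mul ε)
          refine (h1.congr_of_eventuallyEq ?_).congr_deriv ?_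
          · exact Filter.Eventually.of_forall fun t => by simp [hh, ← enorm3_sq]
          · simp
        have hdpos : 0 < ε * (2 * enorm3 z * ((enorm3 z)⁻¹ * dot3 z (u z))) := by
          have := lt_of_le_of_ne (enorm3_nonneg z) hzne.symm
          positivity
        have hcont : ∀ᶠ t in nhdsWithin (0 : ℝ) (Set.Ioi 0), enorm3 (z + t • u z) < r₁ := by
          have h1 : ContinuousAt (fun t : ℝ => enorm3 (z + t • u z)) 0 := hnl.continuousAt
          exact (h1.eventually (gt_mem_nhds (by simpa using hzr))).filter_mono nhdsWithin_le_nhds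
        obtain ⟨t, ht1, ht2, ht3⟩ := ((hhl.eventually_lt_nhdsGT hdpos).and
          ((hnl.eventually_lt_nhdsGT hpos).and hcont)).exists
        rw [zero_smul, add_zero] at ht1 ht2
        have := hmax (show z + t • u z ∈ {y | enorm3 x ≤ enorm3 y ∧ enorm3 y ≤ r₁} from
          ⟨hz.1.trans ht2.le, ht3.le⟩)
        simp only [Set.mem_ofPred_eq] at this
        linarith
    refine le_of_forall_pos_le_add fun δ hδ => ?_
    have h1 := hε (δ / (r₁ ^ 2 + 1)) (by positivity)
    have h2 : δ / (r₁ ^ 2 + 1) * r₁ ^ 2 ≤ δ := by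
      rw [div_mul_eq_mul_div, div_le_iff₀ (by positivity)]
      nlinarith
    linarith
  intro x hx0 hx1
  refine le_antisymm (upper f c hf hd ht hb x hx0 hx1) ?_
  have := upper (fun y => -f y) (-c) hf.neg (fun y h1 h2 => (hd y h1 h2).neg)
    (fun y h1 h2 => by
      rw [fderiv_fun_neg, neg_apply, ht y h1 h2, neg_zero]) (fun y hy => by simp [hb y hy]) x hx0 hx1
  simpa using this

theorem pd_mul {f g : (Fin 3 → ℝ) → ℝ} {x : Fin 3 → ℝ} (j : Fin 3) (hf : DifferentiableAt ℝ f x)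
    (hg : DifferentiableAt ℝ g x) :
    pd j (fun y => f y * g y) x = pd j f x * g x + f x * pd j g x := by
  simp only [pd, fderiv_fun_mul hf hg, add_apply, smul_apply, smul_eq_mul]
  ring

theorem pd_congr {f g : (Fin 3 → ℝ) → ℝ} {x : Fin 3 → ℝ} (j : Fin 3) (h : f =ᶠ[nhds x] g) :
    pd j f x = pd j g x := by
  rw [pd, pd, h.fderiv_eq]

theorem pd_const_of_eventuallyEq {f : (Fin 3 → ℝ) → ℝ} {x : Fin 3 → ℝ} {c : ℝ} (j : Fin 3)
    (h : f =ᶠ[nhds x] fun _ => c) : pd j f x = 0 := by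
  rw [pd_congr j h]
  simp [pd]

/-- The Bernoulli function of a polytropic flow. -/
noncomputable def bernoulliFn (γ : ℝ) (ρ p : (Fin 3 → ℝ) → ℝ) (u : (Fin 3 → ℝ) → Fin 3 → ℝ)
    (x : Fin 3 → ℝ) : ℝ :=
  (∑ i, (u x i) ^ 2) / 2 + γ * p x / ((γ - 1) * ρ x)

theorem differentiableAt_bernoulliFn {γ : ℝ} (hγ : 1 < γ) {ρ p : (Fin 3 → ℝ) → ℝ}
    {u : (Fin 3 → ℝ) → Fin 3 → ℝ} {x : Fin 3 → ℝ} (hρ : DifferentiableAt ℝ ρ x)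
    (hp : DifferentiableAt ℝ p x) (hu : DifferentiableAt ℝ u x) (h : 0 < ρ x) :
    DifferentiableAt ℝ (bernoulliFn γ ρ p u) x := by
  have h1 : ∀ i, DifferentiableAt ℝ (fun y => u y i) x := differentiableAt_pi.1 hu
  have h2 : (γ - 1) * ρ x ≠ 0 := (mul_pos (sub_pos.2 hγ) h).ne'
  unfold bernoulliFn
  fun_prop (disch := assumption)

theorem pd_bernoulliFn {γ : ℝ} (hγ : 1 < γ) {ρ p : (Fin 3 → ℝ) → ℝ}
    {u : (Fin 3 → ℝ) → Fin 3 → ℝ} {x : Fin 3 → ℝ} (hρ : DifferentiableAt ℝ ρ x)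
    (hp : DifferentiableAt ℝ p x) (hu : DifferentiableAt ℝ u x) (h : 0 < ρ x) (j : Fin 3) :
    pd j (bernoulliFn γ ρ p u) x = (∑ i, u x i * pd j (fun y => u y i) x) +
      γ / (γ - 1) * (pd j p x / ρ x - p x * pd j ρ x / ρ x ^ 2) := by
  have h1 : ∀ i, DifferentiableAt ℝ (fun y => u y i) x := differentiableAt_pi.1 hu
  have hγ1 : γ - 1 ≠ 0 := (sub_pos.2 hγ).ne'
  have hd := (differentiableAt_bernoulliFn hγ hρ hp hu h).hasFDerivAt
  have hl : HasDerivAt (fun t : ℝ => x + t • (Pi.single j 1 : Fin 3 → ℝ)) (Pi.single j 1) 0 := by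
    simpa using ((hasDerivAt_id (0 : ℝ)).smul_const (Pi.single j 1 : Fin 3 → ℝ)).const_add x
  have lift : ∀ {f : (Fin 3 → ℝ) → ℝ}, DifferentiableAt ℝ f x →
      HasDerivAt (fun t : ℝ => f (x + t • (Pi.single j 1 : Fin 3 → ℝ))) (pd j f x) 0 := by
    intro f hf
    have : HasFDerivAt f (fderiv ℝ f x) (x + (0 : ℝ) • (Pi.single j 1 : Fin 3 → ℝ)) := by
      simpa using hf.hasFDerivAt
    exact this.comp_hasDerivAt (0 : ℝ) hl
  have h2 := HasDerivAt.fun_sum (u := Finset.univ) fun i _ => (lift (h1 i)).pow 2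
  have h3 := (h2.div_const 2).add (((lift hp).const_mul γ).div ((lift hρ).const_mul (γ - 1))
    (by simpa using mul_ne_zero hγ1 h.ne'))
  have h4 := (lift hd.differentiableAt).unique h3
  rw [h4]
  simp only [zero_smul, add_zero, Finset.sum_div]
  congr 1
  · refine Finset.sum_congr rfl fun i _ => ?_
    simp
    ring
  · have := h.ne'
    field_simp

section EulerPointwise

variable {γ : ℝ} {Ω : Set (Fin 3 → ℝ)} {ρ p : (Fin 3 → ℝ) → ℝ} {u : (Fin 3 → ℝ) → Fin 3 → ℝ}
  {x : Fin 3 → ℝ}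

theorem SteadyEuler.mass (he : SteadyEuler γ Ω ρ p u (fun _ => 0) (fun _ => 0)) (hx : x ∈ Ω)
    (hρ : DifferentiableAt ℝ ρ x) (hu : DifferentiableAt ℝ u x) :
    ∑ j, u x j * pd j ρ x + ρ x * ∑ j, pd j (fun y => u y j) x = 0 := by
  have h1 : ∀ i, DifferentiableAt ℝ (fun y => u y i) x := differentiableAt_pi.1 hu
  have h := (he x hx).2.1
  simp only [pd_mul _ hρ (h1 _), Fin.sum_univ_three] at h ⊢
  linarith

theorem SteadyEuler.momentum (he : SteadyEuler γ Ω ρ p u (fun _ => 0) (fun _ => 0)) (hx : x ∈ Ω)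
    (hρ : DifferentiableAt ℝ ρ x) (hu : DifferentiableAt ℝ u x) (i : Fin 3) :
    ρ x * ∑ j, u x j * pd j (fun y => u y i) x + pd i p x = 0 := by
  have h1 : ∀ i, DifferentiableAt ℝ (fun y => u y i) x := differentiableAt_pi.1 hu
  have h := (he x hx).1 i
  have hm := he.mass hx hρ hu
  simp only [pd_mul _ (hρ.fun_mul (h1 _)) (h1 _), pd_mul _ hρ (h1 _), Fin.sum_univ_three,
    Pi.zero_apply, mul_zero] at h hm ⊢
  linear_combination h - u x i * hm

theorem SteadyEuler.bernoulliFn_transport (he : SteadyEuler γ Ω ρ p u (fun _ => 0) (fun _ => 0))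
    (hx : x ∈ Ω) (hγ : 1 < γ)
    (hρ : DifferentiableAt ℝ ρ x) (hp : DifferentiableAt ℝ p x) (hu : DifferentiableAt ℝ u x)
    (hpos : 0 < ρ x) : ∑ j, u x j * pd j (bernoulliFn γ ρ p u) x = 0 := by
  have h1 : ∀ i, DifferentiableAt ℝ (fun y => u y i) x := differentiableAt_pi.1 hu
  have hb := differentiableAt_bernoulliFn hγ hρ hp hu hpos
  have h : ∑ j, pd j (fun y => ρ y * bernoulliFn γ ρ p u y * u y j) x = 0 := by
    simpa [bernoulliFn] using (he x hx).2.2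
  have hm := he.mass hx hρ hu
  simp only [pd_mul _ (hρ.fun_mul hb) (h1 _), pd_mul _ hρ hb, Fin.sum_univ_three] at h hm ⊢
  apply mul_left_cancel₀ hpos.ne'
  linear_combination h - bernoulliFn γ ρ p u x * hm

theorem SteadyEuler.pressure_transport (he : SteadyEuler γ Ω ρ p u (fun _ => 0) (fun _ => 0))
    (hx : x ∈ Ω) (hγ : 1 < γ)
    (hρ : DifferentiableAt ℝ ρ x) (hp : DifferentiableAt ℝ p x) (hu : DifferentiableAt ℝ u x)
    (hpos : 0 < ρ x) : ρ x * ∑ j, u x j * pd j p x = γ * p x * ∑ j, u x j * pd j ρ x := by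
  have hγ1 : γ - 1 ≠ 0 := (sub_pos.2 hγ).ne'
  have hb := he.bernoulliFn_transport hx hγ hρ hp hu hpos
  have hm := fun i => he.momentum hx hρ hu i
  simp only [pd_bernoulliFn hγ hρ hp hu hpos, Fin.sum_univ_three] at hb hm ⊢
  have m0 := hm 0
  have m1 := hm 1
  have m2 := hm 2
  have := hpos.ne'
  field_simp at hb
  linear_combination hb - (γ - 1) * ρ x * (u x 0 * m0 + u x 1 * m1 + u x 2 * m2)

end EulerPointwise

theorem pd_entropy {γ : ℝ} {ρ p : (Fin 3 → ℝ) → ℝ} {x : Fin 3 → ℝ} (hρ : DifferentiableAt ℝ ρ x)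
    (hp : DifferentiableAt ℝ p x) (h : 0 < ρ x) (j : Fin 3) :
    ρ x * pd j (fun y => p y * ρ y ^ (-γ)) x =
      ρ x ^ (-γ) * (ρ x * pd j p x - γ * p x * pd j ρ x) := by
  have hr : HasFDerivAt (fun y => ρ y ^ (-γ)) ((-γ * ρ x ^ (-γ - 1)) • fderiv ℝ ρ x) x :=
    hρ.hasFDerivAt.rpow_const (Or.inl h.ne')
  rw [pd_mul j hp hr.differentiableAt]
  have h1 : pd j (fun y => ρ y ^ (-γ)) x = -γ * ρ x ^ (-γ - 1) * pd j ρ x := by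
    rw [pd, hr.fderiv]
    simp [pd]
  rw [h1, Real.rpow_sub_one h.ne']
  field_simp
  ring

theorem pd_apply {u : (Fin 3 → ℝ) → Fin 3 → ℝ} {x : Fin 3 → ℝ} (hu : DifferentiableAt ℝ u x)
    (i j : Fin 3) : pd j (fun y => u y i) x = fderiv ℝ u x (Pi.single j 1) i := by
  rw [pd, (hasFDerivAt_pi'.1 hu.hasFDerivAt i).fderiv]
  rfl

theorem pd_pd_comm {f : (Fin 3 → ℝ) → ℝ} {x : Fin 3 → ℝ} (hf : ContDiffAt ℝ 2 f x) (i j : Fin 3) :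
    pd i (pd j f) x = pd j (pd i f) x := by
  have h1 : DifferentiableAt ℝ (fderiv ℝ f) x :=
    (hf.fderiv_right (m := 1) (by norm_num)).differentiableAt (by norm_num)
  have h2 : ∀ i j, pd i (pd j f) x = fderiv ℝ (fderiv ℝ f) x (Pi.single i 1) (Pi.single j 1) := by
    intro i j
    have : HasFDerivAt (pd j f) _ x := h1.hasFDerivAt.clm_apply
      (hasFDerivAt_const (Pi.single j 1 : Fin 3 → ℝ) x)
    rw [pd, this.fderiv]
    simp
  rw [h2, h2]
  exact hf.isSymmSndFDerivAt (by simp) _ _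

/-- The curl of a linear velocity field. -/
noncomputable def curlCLM (L : (Fin 3 → ℝ) →L[ℝ] (Fin 3 → ℝ)) : Fin 3 → ℝ :=
  ![L (Pi.single 1 1) 2 - L (Pi.single 2 1) 1, L (Pi.single 2 1) 0 - L (Pi.single 0 1) 2,
    L (Pi.single 0 1) 1 - L (Pi.single 1 1) 0]

theorem continuous_curlCLM : Continuous curlCLM := by
  refine continuous_pi fun i => ?_
  fin_cases i <;> simp [curlCLM] <;> fun_prop

/-- In a flow with constant Bernoulli function and entropy, velocity and vorticity are parallel. -/
theorem SteadyEuler.crocco {γ : ℝ} {Ω : Set (Fin 3 → ℝ)} {ρ p : (Fin 3 → ℝ) → ℝ}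
    {u : (Fin 3 → ℝ) → Fin 3 → ℝ} {x : Fin 3 → ℝ}
    (he : SteadyEuler γ Ω ρ p u (fun _ => 0) (fun _ => 0))
    (hx : x ∈ Ω) (hγ : 1 < γ)
    (hρ : DifferentiableAt ℝ ρ x) (hp : DifferentiableAt ℝ p x) (hu : DifferentiableAt ℝ u x)
    (hpos : 0 < ρ x) (hB : ∀ j, pd j (bernoulliFn γ ρ p u) x = 0)
    (hA : ∀ j, ρ x * pd j p x = γ * p x * pd j ρ x) (i : Fin 3) :
    ∑ j, u x j * (pd i (fun y => u y j) x - pd j (fun y => u y i) x) = 0 := by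
  have hγ1 : γ - 1 ≠ 0 := (sub_pos.2 hγ).ne'
  have hm := he.momentum hx hρ hu i
  have hb := hB i
  rw [pd_bernoulliFn hγ hρ hp hu hpos] at hb
  have ha := hA i
  have h0 := hpos.ne'
  have h1 : γ / (γ - 1) * (pd i p x / ρ x - p x * pd i ρ x / ρ x ^ 2) = pd i p x / ρ x := by
    field_simp
    linear_combination ha
  rw [h1] at hb
  simp only [Fin.sum_univ_three] at hb hm ⊢
  field_simp at hb
  apply mul_left_cancel₀ h0
  linear_combination hb - hm

theorem sum_pd_curlCLM {u : (Fin 3 → ℝ) → Fin 3 → ℝ} {x : Fin 3 → ℝ} (hu : ContDiffAt ℝ 2 u x) :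
    ∑ i, pd i (fun y => curlCLM (fderiv ℝ u y) i) x = 0 := by
  have hui : ∀ i, ContDiffAt ℝ 2 (fun y => u y i) x := contDiffAt_pi.1 hu
  have hev : ∀ᶠ y in nhds x, DifferentiableAt ℝ u y := by
    filter_upwards [hu.eventually (by simp)] with y hy
    exact hy.differentiableAt (by norm_num)
  have hpd : ∀ i j, DifferentiableAt ℝ (pd j (fun y => u y i)) x := by
    intro i j
    have h1 : DifferentiableAt ℝ (fderiv ℝ (fun y => u y i)) x :=
      ((hui i).fderiv_right (m := 1) (by norm_num)).differentiableAt (by norm_num)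
    exact h1.clm_apply (differentiableAt_const _)
  have hsub : ∀ i j k l m, pd m (fun y => fderiv ℝ u y (Pi.single j 1) i -
      fderiv ℝ u y (Pi.single l 1) k) x =
      pd m (pd j (fun y => u y i)) x - pd m (pd l (fun y => u y k)) x := by
    intro i j k l m
    have : (fun y => fderiv ℝ u y (Pi.single j 1) i - fderiv ℝ u y (Pi.single l 1) k) =ᶠ[nhds x]
        fun y => pd j (fun y => u y i) y - pd l (fun y => u y k) y := by
      filter_upwards [hev] with y hy
      rw [pd_apply hy, pd_apply hy]
    rw [pd_congr m this, pd, fderiv_fun_sub (hpd i j) (hpd k l)]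
    rfl
  simp only [Fin.sum_univ_three, curlCLM, Matrix.cons_val_zero, Matrix.cons_val_one,
    Matrix.cons_val]
  rw [hsub, hsub, hsub, pd_pd_comm (hui 2) 0 1, pd_pd_comm (hui 1) 0 2, pd_pd_comm (hui 0) 1 2]
  ring

/-- A field annihilated by cross product with `u` is a multiple of `u`. -/
theorem eq_smul_of_cross_eq_zero {w u x : Fin 3 → ℝ} (hux : ∑ i, u i * x i ≠ 0)
    (h01 : w 0 * u 1 = w 1 * u 0) (h02 : w 0 * u 2 = w 2 * u 0) (h12 : w 1 * u 2 = w 2 * u 1)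
    (i : Fin 3) : w i = (∑ k, w k * x k) / (∑ k, u k * x k) * u i := by
  rw [div_mul_eq_mul_div, eq_div_iff hux]
  simp only [Fin.sum_univ_three]
  fin_cases i <;> simp only [Fin.zero_eta, Fin.mk_one, Fin.reduceFinMk]
  · linear_combination x 1 * h01 + x 2 * h02
  · linear_combination -x 0 * h01 + x 2 * h12
  · linear_combination -x 0 * h02 - x 1 * h12

theorem transport_of_divergence_free {ρ lam : (Fin 3 → ℝ) → ℝ} {u w : (Fin 3 → ℝ) → Fin 3 → ℝ}
    {x : Fin 3 → ℝ} (hρ : DifferentiableAt ℝ ρ x) (hu : DifferentiableAt ℝ u x)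
    (hl : DifferentiableAt ℝ lam x) (hpos : 0 < ρ x)
    (hm : ∑ j, u x j * pd j ρ x + ρ x * ∑ j, pd j (fun y => u y j) x = 0)
    (hw : ∀ i, (fun y => w y i) =ᶠ[nhds x] fun y => lam y * u y i)
    (hdiv : ∑ i, pd i (fun y => w y i) x = 0) :
    fderiv ℝ (fun y => lam y / ρ y) x (u x) = 0 := by
  have h1 : ∀ i, DifferentiableAt ℝ (fun y => u y i) x := differentiableAt_pi.1 hu
  have hq : DifferentiableAt ℝ (fun y => lam y / ρ y) x := by
    simp only [div_eq_mul_inv]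
    exact hl.fun_mul (hρ.fun_inv hpos.ne')
  have h2 : ∀ j, pd j lam x = pd j (fun y => lam y / ρ y) x * ρ x + lam x / ρ x * pd j ρ x := by
    intro j
    rw [← pd_mul j hq hρ]
    refine pd_congr j ?_
    filter_upwards [hρ.continuousAt.eventually (lt_mem_nhds hpos)] with y hy
    field_simp
  rw [← sum_mul_pd]
  simp only [pd_congr _ (hw _), pd_mul _ hl (h1 _), h2, Fin.sum_univ_three] at hdiv hm ⊢
  have h0 := hpos.ne'
  field_simp at hdiv
  apply mul_left_cancel₀ (pow_ne_zero 2 h0)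
  linear_combination hdiv - lam x * hm

/-- The normal component of the vorticity vanishes on a sphere to which the field is normal. -/
theorem curlCLM_normal_eq_zero {r₁ : ℝ} {S : Set (Fin 3 → ℝ)} {u : (Fin 3 → ℝ) → Fin 3 → ℝ}
    {L : (Fin 3 → ℝ) →L[ℝ] (Fin 3 → ℝ)} {x : Fin 3 → ℝ} (hL : HasFDerivWithinAt u L S x)
    (hr : 0 < r₁) (hS : ∀ y, enorm3 y = r₁ → y ∈ S) (hx : enorm3 x = r₁)
    (hn : ∀ y, enorm3 y = r₁ → ∀ i j, u y i * y j = u y j * y i) :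
    ∑ i, curlCLM L i * x i = 0 := by
  have key : ∀ v : Fin 3 → ℝ, ∀ c : ℝ → Fin 3 → ℝ, c 0 = x → (∀ t, enorm3 (c t) = r₁) →
      HasDerivAt c v 0 → ∀ i j, L v i * x j + u x i * v j = L v j * x i + u x j * v i := by
    intro v c hc0 hc hcd i j
    have h1 : HasDerivAt (fun t => u (c t)) (L v) 0 := by
      rw [← hasDerivWithinAt_univ]
      have := hL.comp_hasDerivWithinAt_of_eq (0 : ℝ) (f := c) (s := Set.univ)
        hcd.hasDerivWithinAt (fun t _ => hS _ (hc t)) hc0.symm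
      exact this
    have h2 := hasDerivAt_pi.1 h1
    have h3 := hasDerivAt_pi.1 hcd
    have h4 := (h2 i).mul (h3 j)
    have h5 := (h2 j).mul (h3 i)
    have h6 : (fun t => u (c t) i) * (fun t => c t j) = (fun t => u (c t) j) * fun t => c t i := by
      funext t
      exact hn _ (hc t) i j
    rw [h6] at h4
    have := h4.unique h5
    simpa [hc0] using this
  have hrot : ∀ a b : ℝ, HasDerivAt (fun t : ℝ => Real.cos t * a - Real.sin t * b) (-b) 0 := by
    intro a b
    have := ((Real.hasDerivAt_cos 0).mul_const a).sub ((Real.hasDerivAt_sin 0).mul_const b)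
    exact this.congr_deriv (by simp)
  have hrot' : ∀ a b : ℝ, HasDerivAt (fun t : ℝ => Real.sin t * a + Real.cos t * b) a 0 := by
    intro a b
    have := ((Real.hasDerivAt_sin 0).mul_const a).add ((Real.hasDerivAt_cos 0).mul_const b)
    exact this.congr_deriv (by simp)
  have hnorm : ∀ y : Fin 3 → ℝ, (∑ i, (y i) ^ 2 = ∑ i, (x i) ^ 2) → enorm3 y = r₁ := by
    intro y hy
    rw [← hx, enorm3, enorm3, hy]
  have k2 := key ![-x 1, x 0, 0] (fun t => ![Real.cos t * x 0 - Real.sin t * x 1,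
      Real.sin t * x 0 + Real.cos t * x 1, x 2])
    (by ext i; fin_cases i <;> simp)
    (fun t => hnorm _ (by
      simp only [Fin.sum_univ_three, Matrix.cons_val]
      linear_combination (x 0 ^ 2 + x 1 ^ 2) * Real.sin_sq_add_cos_sq t))
    (by
      refine hasDerivAt_pi.2 fun i => ?_
      fin_cases i
      · exact hrot _ _
      · exact hrot' _ _
      · exact hasDerivAt_const _ _)
  have k0 := key ![0, -x 2, x 1] (fun t => ![x 0, Real.cos t * x 1 - Real.sin t * x 2,
      Real.sin t * x 1 + Real.cos t * x 2])
    (by ext i; fin_cases i <;> simp)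
    (fun t => hnorm _ (by
      simp only [Fin.sum_univ_three, Matrix.cons_val]
      linear_combination (x 1 ^ 2 + x 2 ^ 2) * Real.sin_sq_add_cos_sq t))
    (by
      refine hasDerivAt_pi.2 fun i => ?_
      fin_cases i
      · exact hasDerivAt_const _ _
      · exact hrot _ _
      · exact hrot' _ _)
  have k1 := key ![x 2, 0, -x 0] (fun t => ![Real.sin t * x 2 + Real.cos t * x 0, x 1,
      Real.cos t * x 2 - Real.sin t * x 0])
    (by ext i; fin_cases i <;> simp)
    (fun t => hnorm _ (by
      simp only [Fin.sum_univ_three, Matrix.cons_val]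
      linear_combination (x 0 ^ 2 + x 2 ^ 2) * Real.sin_sq_add_cos_sq t))
    (by
      refine hasDerivAt_pi.2 fun i => ?_
      fin_cases i
      · exact hrot' _ _
      · exact hasDerivAt_const _ _
      · exact hrot _ _)
  have expand : ∀ v : Fin 3 → ℝ, ∀ i, L v i = ∑ j, v j * L (Pi.single j 1) i := by
    intro v i
    conv_lhs => rw [pi_eq_sum_univ' v]
    simp
  have e := fun i => expand ![-x 1, x 0, 0] i
  have e' := fun i => expand ![0, -x 2, x 1] i
  have e'' := fun i => expand ![x 2, 0, -x 0] i
  simp only [e, e', e'', Fin.sum_univ_three, Matrix.cons_val] at k0 k1 k2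
  have hx2 : x 0 ^ 2 + x 1 ^ 2 + x 2 ^ 2 ≠ 0 := by
    have := enorm3_sq x
    rw [hx, Fin.sum_univ_three] at this
    rw [← this]
    positivity
  apply mul_left_cancel₀ hx2
  simp only [curlCLM, Fin.sum_univ_three, Matrix.cons_val]
  have a1 := k0 0 1
  have a2 := k0 0 2
  have b1 := k1 0 1
  have b3 := k1 1 2
  have c2 := k2 0 2
  have c3 := k2 1 2
  simp only [Matrix.cons_val] at a1 a2 b1 b3 c2 c3
  linear_combination x 1 * a1 + x 2 * a2 + x 2 * b3 - x 0 * b1 - x 0 * c2 - x 1 * c3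

theorem ContinuousOn.prodMk_left_slice {X Y Z : Type*} [TopologicalSpace X] [TopologicalSpace Y]
    [TopologicalSpace Z] {f : X × Y → Z} {s : Set X} {t : Set Y} (hf : ContinuousOn f (s ×ˢ t))
    {x : X} (hx : x ∈ s) : ContinuousOn (fun y => f (x, y)) t :=
  hf.comp (by fun_prop) (fun _ hy => ⟨hx, hy⟩)

set_option maxHeartbeats 1000000 in
/-- Primitive of a closed `1`-form along a homotopy `x + t • d x` whose endpoint map
annihilates the form. -/
theorem hasFDerivAt_primitive_of_closed {E : Type*} [NormedAddCommGroup E] [NormedSpace ℝ E]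
    [ProperSpace E] {O S : Set E} (hO : IsOpen O) (hOS : O ⊆ S)
    {α : E → E →L[ℝ] ℝ} {α' : E → E →L[ℝ] E →L[ℝ] ℝ}
    (hα : ContinuousOn α S) (hα' : ContinuousOn α' S)
    (hder : ∀ x ∈ O, HasFDerivAt α (α' x) x)
    (hsymm : ∀ x ∈ O, ∀ v w, α' x v w = α' x w v)
    {d : E → E} {d' : E → E →L[ℝ] E} (hd : ∀ x ∈ O, HasFDerivAt d (d' x) x)
    (hd' : ContinuousOn d' O)
    (hin : ∀ x ∈ O, ∀ t ∈ Set.Ico (0 : ℝ) 1, x + t • d x ∈ O)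
    (hend : ∀ x ∈ O, x + d x ∈ S)
    (hker : ∀ x ∈ O, ∀ v, α (x + d x) (v + d' x v) = 0) {x : E} (hx : x ∈ O) :
    HasFDerivAt (fun x => -∫ t in (0 : ℝ)..1, α (x + t • d x) (d x)) (α x) x := by
  have hdc : ContinuousOn d O := fun y hy => (hd y hy).continuousAt.continuousWithinAt
  have hmaps : ∀ y ∈ O, ∀ t ∈ Set.Icc (0 : ℝ) 1, y + t • d y ∈ S := by
    intro y hy t ht
    rcases ht.2.eq_or_lt with h | h
    · simpa [h] using hend y hy
    · exact hOS (hin y hy t ⟨ht.1, h⟩)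
  set F : E → ℝ → ℝ := fun y t => α (y + t • d y) (d y) with hF
  set F' : E → ℝ → E →L[ℝ] ℝ := fun y t =>
    (α (y + t • d y)).comp (d' y) +
      ((α' (y + t • d y)).comp (ContinuousLinearMap.id ℝ E + t • d' y)).flip (d y) with hF'
  have hline : ContinuousOn (fun q : E × ℝ => q.1 + q.2 • d q.1) (O ×ˢ Set.Icc 0 1) := by
    have h1 : ContinuousOn (fun q : E × ℝ => d q.1) (O ×ˢ Set.Icc 0 1) :=
      hdc.comp continuousOn_fst (fun q hq => hq.1)
    exact continuousOn_fst.add (continuousOn_snd.smul h1)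
  have hlm : Set.MapsTo (fun q : E × ℝ => q.1 + q.2 • d q.1) (O ×ˢ Set.Icc 0 1) S :=
    fun q hq => hmaps q.1 hq.1 q.2 hq.2
  have hdq : ContinuousOn (fun q : E × ℝ => d q.1) (O ×ˢ Set.Icc 0 1) :=
    hdc.comp continuousOn_fst (fun q hq => hq.1)
  have hd'q : ContinuousOn (fun q : E × ℝ => d' q.1) (O ×ˢ Set.Icc 0 1) :=
    hd'.comp continuousOn_fst (fun q hq => hq.1)
  have hαq : ContinuousOn (fun q : E × ℝ => α (q.1 + q.2 • d q.1)) (O ×ˢ Set.Icc 0 1) :=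
    hα.comp hline hlm
  have hα'q : ContinuousOn (fun q : E × ℝ => α' (q.1 + q.2 • d q.1)) (O ×ˢ Set.Icc 0 1) :=
    hα'.comp hline hlm
  have hFc : ContinuousOn (fun q : E × ℝ => F q.1 q.2) (O ×ˢ Set.Icc 0 1) := hαq.clm_apply hdq
  have hF'c : ContinuousOn (fun q : E × ℝ => F' q.1 q.2) (O ×ˢ Set.Icc 0 1) := by
    refine (hαq.clm_comp hd'q).add ?_
    have h2 : ContinuousOn (fun q : E × ℝ => ContinuousLinearMap.id ℝ E + q.2 • d' q.1)
        (O ×ˢ Set.Icc 0 1) := continuousOn_const.add (continuousOn_snd.smul hd'q)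
    have h3 := hα'q.clm_comp h2
    have h4 := (ContinuousLinearMap.flipₗᵢ ℝ E E ℝ).continuous.comp_continuousOn h3
    exact h4.clm_apply hdq
  obtain ⟨ε, hε, hball⟩ := Metric.nhds_basis_closedBall.mem_iff.1 (hO.mem_nhds hx)
  have hcomp : IsCompact (Metric.closedBall x ε ×ˢ Set.Icc (0 : ℝ) 1) :=
    (isCompact_closedBall x ε).prod isCompact_Icc
  obtain ⟨C, hC⟩ := hcomp.exists_bound_of_continuousOn
    (hF'c.mono (Set.prod_mono hball le_rfl))
  have hIoc : Set.uIoc (0 : ℝ) 1 = Set.Ioc 0 1 := Set.uIoc_of_le zero_le_one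
  have hne : ∀ᵐ t : ℝ ∂MeasureTheory.volume, t ≠ 1 := by
    simp [MeasureTheory.ae_iff]
  have hderF : ∀ y ∈ O, ∀ t ∈ Set.Ico (0 : ℝ) 1, HasFDerivAt (fun y => F y t) (F' y t) y := by
    intro y hy t ht
    have h1 : HasFDerivAt (fun y => y + t • d y) (ContinuousLinearMap.id ℝ E + t • d' y) y :=
      (hasFDerivAt_id y).add ((hd y hy).const_smul t)
    exact ((hder _ (hin y hy t ht)).comp y h1).clm_apply (hd y hy)
  have key := intervalIntegral.hasFDerivAt_integral_of_dominated_of_fderiv_le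
    (μ := MeasureTheory.volume) (F := F) (F' := F') (x₀ := x) (a := 0) (b := 1)
    (s := Metric.closedBall x ε) (bound := fun _ => C) (Metric.closedBall_mem_nhds x hε)
    (by
      filter_upwards [hO.mem_nhds hx] with y hy
      rw [hIoc]
      exact ((hFc.prodMk_left_slice hy).mono Set.Ioc_subset_Icc_self).aestronglyMeasurable measurableSet_Ioc)
    (by
      apply ContinuousOn.intervalIntegrable
      rw [Set.uIcc_of_le zero_le_one]
      exact hFc.prodMk_left_slice hx)
    (by
      rw [hIoc]
      exact ((hF'c.prodMk_left_slice hx).mono Set.Ioc_subset_Icc_self).aestronglyMeasurable measurableSet_Ioc)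
    (Filter.Eventually.of_forall fun t ht y hy => by
      rw [hIoc] at ht
      exact hC (y, t) ⟨hy, ht.1.le, ht.2⟩)
    (by simp)
    (by
      filter_upwards [hne] with t h1 ht y hy
      rw [hIoc] at ht
      exact hderF y (hball hy) t ⟨ht.1.le, lt_of_le_of_ne ht.2 h1⟩)
  refine key.neg.congr_fderiv ?_
  have hF'int : IntervalIntegrable (F' x) MeasureTheory.volume 0 1 := by
    apply ContinuousOn.intervalIntegrable
    rw [Set.uIcc_of_le zero_le_one]
    exact hF'c.prodMk_left_slice hx
  ext v
  rw [neg_apply, ContinuousLinearMap.intervalIntegral_apply hF'int]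
  have hftc := intervalIntegral.integral_eq_sub_of_hasDerivAt_of_le (a := 0) (b := 1)
    (f := fun t => α (x + t • d x) (v + t • d' x v)) (f' := fun t => F' x t v) zero_le_one
    ((hαq.prodMk_left_slice hx).clm_apply (by fun_prop))
    (by
      intro t ht
      have hO' := hin x hx t ⟨ht.1.le, ht.2⟩
      have h1 : HasDerivAt (fun t : ℝ => x + t • d x) (d x) t := by
        simpa using ((hasDerivAt_id t).smul_const (d x)).const_add x
      have h2 : HasDerivAt (fun t : ℝ => v + t • d' x v) (d' x v) t := by
        simpa using ((hasDerivAt_id t).smul_const (d' x v)).const_add v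
      have h3 := ((hder _ hO').comp_hasDerivAt t h1).clm_apply h2
      refine h3.congr_deriv (Eq.symm ?_)
      simp only [hF', add_apply, ContinuousLinearMap.comp_apply,
        ContinuousLinearMap.flip_apply, smul_apply,
        ContinuousLinearMap.id_apply]
      rw [hsymm _ hO' _ (d x)]
      simp only [Function.comp]
      ring)
    (by
      apply ContinuousOn.intervalIntegrable
      rw [Set.uIcc_of_le zero_le_one]
      exact (hF'c.prodMk_left_slice hx).clm_apply continuousOn_const)
  rw [hftc]
  simp [hker x hx v]

/-- Mass flux of a flow with Bernoulli constant `E` as a function of the speed,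
up to a constant factor. -/
noncomputable def massFlux (γ E q : ℝ) : ℝ := q * (E - q ^ 2 / 2) ^ (1 / (γ - 1))

section MassFlux

variable {γ E : ℝ}

theorem hasStrictDerivAt_massFlux (hγ : 1 < γ) {q : ℝ} (hq : 0 < E - q ^ 2 / 2) :
    HasStrictDerivAt (massFlux γ E) ((E - q ^ 2 / 2) ^ (1 / (γ - 1)) *
      (((γ - 1) * (E - q ^ 2 / 2) - q ^ 2) / ((γ - 1) * (E - q ^ 2 / 2)))) q := by
  have hγ1 : γ - 1 ≠ 0 := (sub_pos.2 hγ).ne'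
  have h1 : HasStrictDerivAt (fun q : ℝ => E - q ^ 2 / 2) (-q) q := by
    have := (((hasStrictDerivAt_id q).pow 2).div_const 2).const_sub E
    refine this.congr_deriv ?_
    simp
  have h2 : HasStrictDerivAt (fun q : ℝ => (E - q ^ 2 / 2) ^ (1 / (γ - 1)))
      (1 / (γ - 1) * (E - q ^ 2 / 2) ^ (1 / (γ - 1) - 1) * -q) q :=
    HasStrictDerivAt.comp (h₂ := fun y : ℝ => y ^ (1 / (γ - 1))) q
      (Real.hasStrictDerivAt_rpow_const_of_ne hq.ne' (1 / (γ - 1))) h1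
  refine ((hasStrictDerivAt_id q).mul h2).congr_deriv ?_
  rw [Real.rpow_sub_one hq.ne']
  simp only [id]
  generalize E - q ^ 2 / 2 = X at hq
  generalize X ^ (1 / (γ - 1)) = Y
  field_simp
  ring

theorem continuous_massFlux (hγ : 1 < γ) : Continuous (massFlux γ E) := by
  have : 0 ≤ 1 / (γ - 1) := one_div_nonneg.2 (sub_pos.2 hγ).le
  unfold massFlux
  exact continuous_id.mul ((by fun_prop : Continuous fun q : ℝ => E - q ^ 2 / 2).rpow_const
    fun _ => Or.inr this)

theorem sq_lt_of_lt_critical (hγ : 1 < γ) {q : ℝ} (h0 : 0 ≤ q) :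
    q < √(2 * (γ - 1) * E / (γ + 1)) ↔ q ^ 2 < (γ - 1) * (E - q ^ 2 / 2) := by
  have h1 : 0 < γ + 1 := by linarith
  rw [Real.lt_sqrt h0, lt_div_iff₀ h1]
  constructor <;> intro h <;> linarith

theorem strictMonoOn_massFlux (hγ : 1 < γ) (hE : 0 < E) :
    StrictMonoOn (massFlux γ E) (Set.Icc 0 √(2 * (γ - 1) * E / (γ + 1))) := by
  refine strictMonoOn_of_deriv_pos (convex_Icc _ _) (continuous_massFlux hγ).continuousOn ?_
  intro q hq
  rw [interior_Icc] at hq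
  have h1 := (sq_lt_of_lt_critical hγ hq.1.le).1 hq.2
  have hγ1 := sub_pos.2 hγ
  have h2 : 0 < E - q ^ 2 / 2 := by
    by_contra! h
    nlinarith [sq_nonneg q]
  rw [(hasStrictDerivAt_massFlux hγ h2).hasDerivAt.deriv]
  have := sub_pos.2 h1
  positivity

/-- The subsonic branch of the inverse of the mass flux. -/
theorem exists_massFlux_inverse (hγ : 1 < γ) (hE : 0 < E) :
    ∃ (M : ℝ) (G : ℝ → ℝ),
      (∀ y, 0 < y → y < M → 0 < G y ∧ (G y) ^ 2 < (γ - 1) * (E - (G y) ^ 2 / 2) ∧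
        massFlux γ E (G y) = y ∧
        HasDerivAt G (((E - (G y) ^ 2 / 2) ^ (1 / (γ - 1)) *
          (((γ - 1) * (E - (G y) ^ 2 / 2) - (G y) ^ 2) /
            ((γ - 1) * (E - (G y) ^ 2 / 2))))⁻¹) y) ∧
      (∀ q, 0 < q → q ^ 2 < (γ - 1) * (E - q ^ 2 / 2) →
        0 < massFlux γ E q ∧ massFlux γ E q < M ∧ G (massFlux γ E q) = q) ∧
      StrictMonoOn G (Set.Ioo 0 M) := by
  set cr := √(2 * (γ - 1) * E / (γ + 1)) with hcr
  have hγ1 := sub_pos.2 hγ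
  have hcr0 : 0 < cr := Real.sqrt_pos.2 (by positivity)
  have hmono := strictMonoOn_massFlux hγ hE
  have hm0 : massFlux γ E 0 = 0 := by simp [massFlux]
  have hmem0 : (0 : ℝ) ∈ Set.Icc 0 cr := ⟨le_rfl, hcr0.le⟩
  have hmem1 : cr ∈ Set.Icc 0 cr := ⟨hcr0.le, le_rfl⟩
  have hex : ∀ y, 0 < y → y < massFlux γ E cr → ∃ q, (0 < q ∧ q < cr) ∧ massFlux γ E q = y := by
    intro y h0 h1
    have := intermediate_value_Ioo hcr0.le (continuous_massFlux hγ).continuousOn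
      (show y ∈ Set.Ioo (massFlux γ E 0) (massFlux γ E cr) from ⟨by rwa [hm0], h1⟩)
    exact this
  choose! G hG1 hG2 using hex
  refine ⟨massFlux γ E cr, G, ?_, ?_, ?_⟩
  · intro y h0 h1
    obtain ⟨hg0, hg1⟩ := hG1 y h0 h1
    have hs := (sq_lt_of_lt_critical hγ hg0.le).1 hg1
    have hpos : 0 < E - (G y) ^ 2 / 2 := by
      by_contra! h
      nlinarith [sq_nonneg (G y)]
    refine ⟨hg0, hs, hG2 y h0 h1, ?_⟩
    have hd := hasStrictDerivAt_massFlux hγ hpos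
    have hne : (E - (G y) ^ 2 / 2) ^ (1 / (γ - 1)) *
        (((γ - 1) * (E - (G y) ^ 2 / 2) - (G y) ^ 2) / ((γ - 1) * (E - (G y) ^ 2 / 2))) ≠ 0 := by
      have := sub_pos.2 hs
      positivity
    have hloc : ∀ᶠ q in nhds (G y), G (massFlux γ E q) = q := by
      filter_upwards [Ioo_mem_nhds hg0 hg1] with q hq
      have hq0 : 0 < massFlux γ E q := by
        rw [← hm0]
        exact hmono hmem0 ⟨hq.1.le, hq.2.le⟩ hq.1
      have hq1 : massFlux γ E q < massFlux γ E cr := hmono ⟨hq.1.le, hq.2.le⟩ hmem1 hq.2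
      obtain ⟨ha, hb⟩ := hG1 _ hq0 hq1
      exact hmono.injOn ⟨ha.le, hb.le⟩ ⟨hq.1.le, hq.2.le⟩ (hG2 _ hq0 hq1)
    have := (hd.to_local_left_inverse hne hloc).hasDerivAt
    rwa [hG2 y h0 h1] at this
  · intro q h0 hq
    have h1 := (sq_lt_of_lt_critical hγ h0.le).2 hq
    have hq0 : 0 < massFlux γ E q := by
      rw [← hm0]
      exact hmono hmem0 ⟨h0.le, h1.le⟩ h0
    have hq1 : massFlux γ E q < massFlux γ E cr := hmono ⟨h0.le, h1.le⟩ hmem1 h1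
    obtain ⟨ha, hb⟩ := hG1 _ hq0 hq1
    exact ⟨hq0, hq1, hmono.injOn ⟨ha.le, hb.le⟩ ⟨h0.le, h1.le⟩ (hG2 _ hq0 hq1)⟩
  · intro y hy z hz hyz
    obtain ⟨ha, hb⟩ := hG1 y hy.1 hy.2
    obtain ⟨hc, hd⟩ := hG1 z hz.1 hz.2
    rw [← hmono.lt_iff_lt ⟨ha.le, hb.le⟩ ⟨hc.le, hd.le⟩, hG2 y hy.1 hy.2, hG2 z hz.1 hz.2]
    exact hyz

/-- Subsonic radial profiles with mass flux `C + ε r` through the sphere of radius `r`. -/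
theorem exists_radial_profiles (hγ : 1 < γ) (hE : 0 < E) {q₀ r₀ r₁ : ℝ} (h0 : 0 < r₀)
    (h01 : r₀ < r₁) (hq : 0 < q₀) (hsub : q₀ ^ 2 < (γ - 1) * (E - q₀ ^ 2 / 2)) :
    ∃ (V K : ℝ → ℝ → ℝ) (ε₀ : ℝ), 0 < ε₀ ∧ V 0 r₀ = q₀ ∧
      (∀ ε, |ε| < ε₀ → ∀ r ∈ Set.Icc r₀ r₁, 0 < V ε r ∧ 0 < K ε r ∧
        (V ε r) ^ 2 < (γ - 1) * (E - (V ε r) ^ 2 / 2) ∧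
        HasDerivAt (V ε) (V ε r * ((γ - 1) * (E - (V ε r) ^ 2 / 2)) * (ε / K ε r - 2 / r) /
          ((γ - 1) * (E - (V ε r) ^ 2 / 2) - (V ε r) ^ 2)) r) ∧
      (∀ ε, |ε| < ε₀ → 0 < ε → q₀ < V ε r₀) ∧
      (∀ ε, |ε| < ε₀ → ε < 0 → V ε r₀ < q₀) ∧
      (∀ r ∈ Set.Icc r₀ r₁, Filter.Tendsto (fun ε => V ε r) (nhds 0) (nhds (V 0 r))) := by
  obtain ⟨M, G, hG, hinv, hmono⟩ := exists_massFlux_inverse hγ hE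
  obtain ⟨hy0, hyM, hGy⟩ := hinv q₀ hq hsub
  set m₀ := massFlux γ E q₀ with hm₀
  have hr1 : 0 < r₁ := h0.trans h01
  obtain ⟨ε₀, hε₀, hε₁, hε₂⟩ : ∃ ε₀ : ℝ, 0 < ε₀ ∧ ε₀ * r₁ < r₀ ^ 2 * m₀ ∧
      ε₀ * r₁ < r₀ ^ 2 * (M - m₀) := by
    have hMm := sub_pos.2 hyM
    have hmin : 0 < min (r₀ ^ 2 * m₀) (r₀ ^ 2 * (M - m₀)) :=
      lt_min (by positivity) (by positivity)
    refine ⟨min (r₀ ^ 2 * m₀) (r₀ ^ 2 * (M - m₀)) / (2 * r₁), by positivity, ?_, ?_⟩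
    · have : min (r₀ ^ 2 * m₀) (r₀ ^ 2 * (M - m₀)) / (2 * r₁) * r₁ =
        min (r₀ ^ 2 * m₀) (r₀ ^ 2 * (M - m₀)) / 2 := by field_simp
      rw [this]
      linarith [min_le_left (r₀ ^ 2 * m₀) (r₀ ^ 2 * (M - m₀))]
    · have : min (r₀ ^ 2 * m₀) (r₀ ^ 2 * (M - m₀)) / (2 * r₁) * r₁ =
        min (r₀ ^ 2 * m₀) (r₀ ^ 2 * (M - m₀)) / 2 := by field_simp
      rw [this]
      linarith [min_le_right (r₀ ^ 2 * m₀) (r₀ ^ 2 * (M - m₀))]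
  have hM : 0 < M := hy0.trans hyM
  have hrange : ∀ ε, |ε| < ε₀ → ∀ r ∈ Set.Icc r₀ r₁, 0 < r₀ ^ 2 * m₀ + ε * r ∧
      0 < (r₀ ^ 2 * m₀ + ε * r) / r ^ 2 ∧ (r₀ ^ 2 * m₀ + ε * r) / r ^ 2 < M := by
    intro ε hε r hr
    have hrpos : 0 < r := h0.trans_le hr.1
    have habs : |ε * r| ≤ ε₀ * r₁ := by
      rw [abs_mul, abs_of_pos hrpos]
      exact mul_le_mul hε.le hr.2 hrpos.le hε₀.le
    have h1 := abs_le.1 habs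
    have h2 : 0 < r₀ ^ 2 * m₀ + ε * r := by linarith [h1.1]
    refine ⟨h2, by positivity, ?_⟩
    rw [div_lt_iff₀ (by positivity)]
    have h3 : r₀ ^ 2 ≤ r ^ 2 := pow_le_pow_left₀ h0.le hr.1 2
    nlinarith [h1.2]
  have hr0mem : r₀ ∈ Set.Icc r₀ r₁ := ⟨le_rfl, h01.le⟩
  have hbase : (r₀ ^ 2 * m₀ + 0 * r₀) / r₀ ^ 2 = m₀ := by field_simp; ring
  refine ⟨fun ε r => G ((r₀ ^ 2 * m₀ + ε * r) / r ^ 2), fun ε r => r₀ ^ 2 * m₀ + ε * r, ε₀, hε₀,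
    ?_, ?_, ?_, ?_, ?_⟩
  · simp only [hbase, hGy]
  · intro ε hε r hr
    obtain ⟨hK, hy1, hy2⟩ := hrange ε hε r hr
    have hrpos : 0 < r := h0.trans_le hr.1
    obtain ⟨hg0, hg1, hg2, hg3⟩ := hG _ hy1 hy2
    refine ⟨hg0, hK, hg1, ?_⟩
    have hin : HasDerivAt (fun r : ℝ => (r₀ ^ 2 * m₀ + ε * r) / r ^ 2)
        ((ε * r ^ 2 - (r₀ ^ 2 * m₀ + ε * r) * (2 * r)) / (r ^ 2) ^ 2) r := by
      have := ((((hasDerivAt_id r).const_mul ε).const_add (r₀ ^ 2 * m₀)).div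
        ((hasDerivAt_id r).pow 2) (by simpa using hrpos.ne'))
      refine this.congr_deriv ?_
      simp
    refine (hg3.comp r hin).congr_deriv ?_
    beta_reduce
    set g := G ((r₀ ^ 2 * m₀ + ε * r) / r ^ 2) with hg
    have hs := sub_pos.2 hg1
    have hγ1 := sub_pos.2 hγ
    have hpos : 0 < E - g ^ 2 / 2 := by
      by_contra! h
      nlinarith [sq_nonneg g]
    have hR : 0 < (E - g ^ 2 / 2) ^ (1 / (γ - 1)) := Real.rpow_pos_of_pos hpos _
    have hmf : g * (E - g ^ 2 / 2) ^ (1 / (γ - 1)) * r ^ 2 = r₀ ^ 2 * m₀ + ε * r := by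
      rw [massFlux] at hg2
      rw [hg2]
      field_simp
    set R := (E - g ^ 2 / 2) ^ (1 / (γ - 1)) with hRdef
    rw [← hmf]
    set c := (γ - 1) * (E - g ^ 2 / 2) with hc
    have hcpos : 0 < c := by positivity
    have hs' := hs.ne'
    field_simp
  · intro ε hε hpos
    have h1 := hrange 0 (by simpa using hε₀) r₀ hr0mem
    have h2 := hrange ε hε r₀ hr0mem
    have : (r₀ ^ 2 * m₀ + 0 * r₀) / r₀ ^ 2 < (r₀ ^ 2 * m₀ + ε * r₀) / r₀ ^ 2 := by
      gcongr
    have h3 := hmono h1.2 h2.2 this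
    rwa [hbase, hGy] at h3
  · intro ε hε hneg
    have h1 := hrange 0 (by simpa using hε₀) r₀ hr0mem
    have h2 := hrange ε hε r₀ hr0mem
    have : (r₀ ^ 2 * m₀ + ε * r₀) / r₀ ^ 2 < (r₀ ^ 2 * m₀ + 0 * r₀) / r₀ ^ 2 := by
      gcongr
    have h3 := hmono h2.2 h1.2 this
    rwa [hbase, hGy] at h3
  · intro r hr
    obtain ⟨-, hy1, hy2⟩ := hrange 0 (by simpa using hε₀) r hr
    have hc : ContinuousAt G ((r₀ ^ 2 * m₀ + 0 * r) / r ^ 2) := (hG _ hy1 hy2).2.2.2.continuousAt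
    have hi : ContinuousAt (fun ε : ℝ => (r₀ ^ 2 * m₀ + ε * r) / r ^ 2) 0 := by fun_prop
    exact ContinuousAt.comp (f := fun ε : ℝ => (r₀ ^ 2 * m₀ + ε * r) / r ^ 2) hc hi

end MassFlux

theorem exists_potential {r₀ r₁ M : ℝ} (h0 : 0 < r₀) (h01 : r₀ < r₁)
    {u : (Fin 3 → ℝ) → Fin 3 → ℝ}
    (hu : ContDiffOn ℝ 1 u {x | r₀ < enorm3 x ∧ enorm3 x ≤ r₁})
    (hM : ∀ x, r₀ < enorm3 x → enorm3 x ≤ r₁ → ‖dot3 (u x)‖ ≤ M)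
    (hcurl : ∀ x, r₀ < enorm3 x → enorm3 x < r₁ → ∀ i j,
      pd i (fun y => u y j) x = pd j (fun y => u y i) x)
    (hn : ∀ x, enorm3 x = r₁ → ∀ i j, u x i * x j = u x j * x i) :
    ∃ φ : (Fin 3 → ℝ) → ℝ,
      (∀ x, r₀ < enorm3 x → enorm3 x < r₁ → HasFDerivAt φ (dot3 (u x)) x) ∧
      (∀ x, enorm3 x = r₁ → φ x = 0) ∧
      ContinuousOn φ {x | r₀ < enorm3 x ∧ enorm3 x ≤ r₁} := by
  set O : Set (Fin 3 → ℝ) := {x | r₀ < enorm3 x ∧ enorm3 x < r₁} with hO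
  set S : Set (Fin 3 → ℝ) := {x | r₀ < enorm3 x ∧ enorm3 x ≤ r₁} with hS
  have hr1 : 0 < r₁ := h0.trans h01
  have hOo : IsOpen O := isOpen_openShell r₀ r₁
  have hOS : O ⊆ S := fun x hx => ⟨hx.1, hx.2.le⟩
  have hSn : ∀ x ∈ O, S ∈ nhds x := fun x hx => Filter.mem_of_superset (hOo.mem_nhds hx) hOS
  have hdu : ∀ x ∈ O, HasFDerivAt u (fderivWithin ℝ u S x) x := fun x hx =>
    ((hu.differentiableOn (by norm_num)) x (hOS hx)).hasFDerivWithinAt.hasFDerivAt (hSn x hx)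
  set d : (Fin 3 → ℝ) → Fin 3 → ℝ := fun x => (r₁ * (enorm3 x)⁻¹ - 1) • x with hd
  have hseg : ∀ x t, enorm3 x ≠ 0 → 0 ≤ t → t ≤ 1 →
      enorm3 (x + t • d x) = (1 - t) * enorm3 x + t * r₁ := by
    intro x t hx ht0 ht1
    have hx' : 0 < enorm3 x := lt_of_le_of_ne (enorm3_nonneg x) hx.symm
    have : x + t • d x = (1 + t * (r₁ * (enorm3 x)⁻¹ - 1)) • x := by
      simp only [hd, smul_smul, add_smul, one_smul]
    rw [this, enorm3_smul, abs_of_nonneg]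
    · field_simp
      ring
    · have : 0 < r₁ * (enorm3 x)⁻¹ := by positivity
      nlinarith
  have hsegS : ∀ x ∈ S, ∀ t ∈ Set.Icc (0 : ℝ) 1, x + t • d x ∈ S := by
    intro x hx t ht
    have := hseg x t (h0.trans hx.1).ne' ht.1 ht.2
    refine ⟨?_, ?_⟩ <;> rw [this] <;> nlinarith [hx.1, hx.2, ht.1, ht.2]
  have key := fun x (hx : x ∈ O) => hasFDerivAt_primitive_of_closed (x := x) hOo hOS
    (α := fun x => dot3 (u x)) (α' := fun x => dot3.comp (fderivWithin ℝ u S x))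
    (d := d) (d' := fun x => (r₁ * (enorm3 x)⁻¹ - 1) • ContinuousLinearMap.id ℝ (Fin 3 → ℝ) +
      ((-r₁ * (enorm3 x)⁻¹ ^ 3) • dot3 x).smulRight x)
    (dot3.continuous.comp_continuousOn hu.continuousOn)
    (by
      have := hu.continuousOn_fderivWithin (uniqueDiffOn_halfOpenShell r₀ r₁ hr1) (by norm_num)
      exact continuousOn_const.clm_comp this)
    (fun x hx => dot3.hasFDerivAt.comp x (hdu x hx))
    (by
      intro x hx v w
      have h1 : ∀ v i, fderivWithin ℝ u S x v i = ∑ j, v j * pd j (fun y => u y i) x := by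
        intro v i
        rw [sum_mul_pd, (hasFDerivAt_pi'.1 (hdu x hx) i).fderiv]
        rfl
      have hc := hcurl x hx.1 hx.2
      simp only [ContinuousLinearMap.comp_apply, dot3_apply, h1, Fin.sum_univ_three]
      rw [hc 0 1, hc 0 2, hc 1 2]
      ring)
    (by
      intro x hx
      have hx0 : enorm3 x ≠ 0 := (h0.trans hx.1).ne'
      have h1 : HasFDerivAt (fun y => r₁ * (enorm3 y)⁻¹ - 1)
          ((-r₁ * (enorm3 x)⁻¹ ^ 3) • dot3 x) x := by
        refine ((((hasDerivAt_inv hx0).comp_hasFDerivAt x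
          (hasFDerivAt_enorm3 hx0)).const_mul r₁).sub_const 1).congr_fderiv ?_
        ext v
        simp
        ring
      exact h1.smul (hasFDerivAt_id x))
    (by
      have hne : ∀ x ∈ O, enorm3 x ≠ 0 := fun x hx => (h0.trans hx.1).ne'
      have hi : ContinuousOn (fun x => (enorm3 x)⁻¹) O := continuous_enorm3.continuousOn.inv₀ hne
      refine ContinuousOn.add ?_ ?_
      · exact ((continuousOn_const.mul hi).sub continuousOn_const).smul continuousOn_const
      · have h1 : ContinuousOn (fun x => (-r₁ * (enorm3 x)⁻¹ ^ 3) • dot3 x) O :=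
          (continuousOn_const.mul (hi.pow 3)).smul dot3.continuous.continuousOn
        have h2 := (ContinuousLinearMap.smulRightL ℝ (Fin 3 → ℝ) (Fin 3 → ℝ)).continuous
        exact (h2.comp_continuousOn h1).clm_apply continuousOn_id)
    (by
      intro x hx t ht
      have := hseg x t (h0.trans hx.1).ne' ht.1 ht.2.le
      refine ⟨?_, ?_⟩ <;> rw [this] <;> nlinarith [hx.1, hx.2, ht.1, ht.2])
    (by
      intro x hx
      simpa using hsegS x (hOS hx) 1 ⟨zero_le_one, le_rfl⟩)
    (by
      intro x hx v
      have hx0 : 0 < enorm3 x := h0.trans hx.1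
      have hy := hseg x 1 hx0.ne' zero_le_one le_rfl
      simp only [one_smul, sub_self, zero_mul, one_mul, zero_add] at hy
      have hp := hn _ hy
      have hxy : x + d x = (r₁ * (enorm3 x)⁻¹) • x := by
        simp only [hd, sub_smul, one_smul]
        abel
      generalize u (x + d x) = w at hp
      rw [hxy] at hp
      have hk : 0 < r₁ * (enorm3 x)⁻¹ := by positivity
      have hp' : ∀ i j, w i * x j = w j * x i := by
        intro i j
        apply mul_left_cancel₀ hk.ne'
        have := hp i j
        simp only [Pi.smul_apply, smul_eq_mul] at this
        linear_combination this
      have hsq := enorm3_sq x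
      simp only [Fin.sum_univ_three] at hsq
      have hmul : (enorm3 x)⁻¹ = (enorm3 x)⁻¹ ^ 3 * enorm3 x ^ 2 := by field_simp
      simp only [dot3_apply, Fin.sum_univ_three, add_apply, smul_apply, Pi.add_apply,
        ContinuousLinearMap.smulRight_apply, ContinuousLinearMap.id_apply, Pi.smul_apply,
        smul_eq_mul]
      have e : (enorm3 x)⁻¹ = (enorm3 x)⁻¹ ^ 3 * (x 0 ^ 2 + x 1 ^ 2 + x 2 ^ 2) := by
        rw [← hsq]; exact hmul
      generalize (enorm3 x)⁻¹ ^ 3 = k at e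
      rw [e]
      linear_combination r₁ * k * ((v 0 * x 1 - v 1 * x 0) * hp' 0 1 +
        (v 0 * x 2 - v 2 * x 0) * hp' 0 2 + (v 1 * x 2 - v 2 * x 1) * hp' 1 2)) hx
  have hd0 : ∀ x, enorm3 x = r₁ → d x = 0 := by
    intro x hx
    simp [hd, hx, hr1.ne']
  refine ⟨_, fun x hx0 hx1 => key x ⟨hx0, hx1⟩, ?_, ?_⟩
  · intro x hx
    simp [hd0 x hx]
  · intro x hx
    rcases hx.2.lt_or_eq with h | h
    · exact (key x ⟨hx.1, h⟩).continuousAt.continuousWithinAt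
    · have hbound : ∀ y ∈ S, ‖-∫ t in (0 : ℝ)..1, dot3 (u (y + t • d y)) (d y)‖ ≤ M * ‖d y‖ := by
        intro y hy
        rw [norm_neg]
        refine (intervalIntegral.norm_integral_le_of_norm_le_const (C := M * ‖d y‖) ?_).trans
          (by simp)
        intro t ht
        rw [Set.uIoc_of_le zero_le_one] at ht
        have := hsegS y hy t ⟨ht.1.le, ht.2⟩
        exact (ContinuousLinearMap.le_opNorm _ _).trans
          (mul_le_mul_of_nonneg_right (hM _ this.1 this.2) (norm_nonneg _))
      have hdc : ContinuousAt d x := by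
        have : enorm3 x ≠ 0 := by rw [h]; exact hr1.ne'
        exact ((continuousAt_const.mul (continuous_enorm3.continuousAt.inv₀ this)).sub
          continuousAt_const).smul continuousAt_id
      have hlim : Filter.Tendsto (fun y => M * ‖d y‖) (nhdsWithin x S) (nhds 0) := by
        have := (hdc.norm.const_mul M).continuousWithinAt (s := S)
        simpa [ContinuousWithinAt, hd0 x h] using this
      rw [ContinuousWithinAt]
      simp only [hd0 x h, smul_zero, map_zero, intervalIntegral.integral_zero, neg_zero]
      exact squeeze_zero_norm' (by filter_upwards [self_mem_nhdsWithin] with y hy using hbound y hy)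
        hlim

section EulerFlow

variable {γ r₀ r₁ A₁ E₁ : ℝ} {ρ p : (Fin 3 → ℝ) → ℝ} {u : (Fin 3 → ℝ) → Fin 3 → ℝ}

theorem ContDiffOn.differentiableAt_openShell {F : Type*} [NormedAddCommGroup F] [NormedSpace ℝ F]
    {f : (Fin 3 → ℝ) → F} (hf : ContDiffOn ℝ 1 f {x | r₀ < enorm3 x ∧ enorm3 x ≤ r₁})
    {x : Fin 3 → ℝ} (hx0 : r₀ < enorm3 x) (hx1 : enorm3 x < r₁) : DifferentiableAt ℝ f x := by
  refine (hf.differentiableOn (by norm_num)).differentiableAt ?_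
  refine Filter.mem_of_superset ((isOpen_openShell r₀ r₁).mem_nhds ⟨hx0, hx1⟩) ?_
  exact fun y hy => ⟨hy.1, hy.2.le⟩

theorem SteadyEuler.bernoulliFn_eq (hγ : 1 < γ)
    (hρ : ContDiffOn ℝ 1 ρ {x | r₀ < enorm3 x ∧ enorm3 x ≤ r₁})
    (hp : ContDiffOn ℝ 1 p {x | r₀ < enorm3 x ∧ enorm3 x ≤ r₁})
    (hu : ContDiffOn ℝ 1 u {x | r₀ < enorm3 x ∧ enorm3 x ≤ r₁})
    (he : SteadyEuler γ {x | r₀ < enorm3 x ∧ enorm3 x < r₁} ρ p u (fun _ => 0) (fun _ => 0))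
    (hpos : ∀ x, r₀ < enorm3 x → enorm3 x ≤ r₁ → 0 < ρ x ∧ 0 < ∑ i, u x i * x i)
    (hb : ∀ x, enorm3 x = r₁ → bernoulliFn γ ρ p u x = E₁) :
    ∀ x, r₀ < enorm3 x → enorm3 x ≤ r₁ → bernoulliFn γ ρ p u x = E₁ := by
  refine eq_of_transport (u := u) ?_ ?_ ?_ (fun x h0 h1 => (hpos x h0 h1.le).2) hb
  · have h1 : ∀ i, ContinuousOn (fun x => u x i) {x | r₀ < enorm3 x ∧ enorm3 x ≤ r₁} :=
      continuousOn_pi.1 hu.continuousOn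
    unfold bernoulliFn
    refine ((continuousOn_finsetSum _ fun i _ => (h1 i).pow 2).div_const 2).add ?_
    refine (continuousOn_const.mul hp.continuousOn).div (continuousOn_const.mul hρ.continuousOn) ?_
    exact fun x hx => (mul_pos (sub_pos.2 hγ) (hpos x hx.1 hx.2).1).ne'
  · intro x h0 h1
    exact differentiableAt_bernoulliFn hγ (hρ.differentiableAt_openShell h0 h1)
      (hp.differentiableAt_openShell h0 h1) (hu.differentiableAt_openShell h0 h1)
      (hpos x h0 h1.le).1
  · intro x h0 h1
    rw [← sum_mul_pd]
    exact he.bernoulliFn_transport ⟨h0, h1⟩ hγ (hρ.differentiableAt_openShell h0 h1)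
      (hp.differentiableAt_openShell h0 h1) (hu.differentiableAt_openShell h0 h1)
      (hpos x h0 h1.le).1

theorem SteadyEuler.entropy_eq (hγ : 1 < γ)
    (hρ : ContDiffOn ℝ 1 ρ {x | r₀ < enorm3 x ∧ enorm3 x ≤ r₁})
    (hp : ContDiffOn ℝ 1 p {x | r₀ < enorm3 x ∧ enorm3 x ≤ r₁})
    (hu : ContDiffOn ℝ 1 u {x | r₀ < enorm3 x ∧ enorm3 x ≤ r₁})
    (he : SteadyEuler γ {x | r₀ < enorm3 x ∧ enorm3 x < r₁} ρ p u (fun _ => 0) (fun _ => 0))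
    (hpos : ∀ x, r₀ < enorm3 x → enorm3 x ≤ r₁ → 0 < ρ x ∧ 0 < ∑ i, u x i * x i)
    (hb : ∀ x, enorm3 x = r₁ → p x * ρ x ^ (-γ) = A₁) :
    ∀ x, r₀ < enorm3 x → enorm3 x ≤ r₁ → p x * ρ x ^ (-γ) = A₁ := by
  refine eq_of_transport (u := u) ?_ ?_ ?_ (fun x h0 h1 => (hpos x h0 h1.le).2) hb
  · exact hp.continuousOn.mul
      (hρ.continuousOn.rpow_const fun x hx => Or.inl (hpos x hx.1 hx.2).1.ne')
  · intro x h0 h1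
    exact (hp.differentiableAt_openShell h0 h1).fun_mul
      ((hρ.differentiableAt_openShell h0 h1).rpow_const (Or.inl (hpos x h0 h1.le).1.ne'))
  · intro x h0 h1
    have hρx := hρ.differentiableAt_openShell h0 h1
    have hpx := hp.differentiableAt_openShell h0 h1
    have hρp := (hpos x h0 h1.le).1
    have h := he.pressure_transport ⟨h0, h1⟩ hγ hρx hpx (hu.differentiableAt_openShell h0 h1) hρp
    rw [← sum_mul_pd]
    have hj := pd_entropy (γ := γ) hρx hpx hρp
    apply mul_left_cancel₀ hρp.ne'
    simp only [Fin.sum_univ_three] at h ⊢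
    linear_combination u x 0 * hj 0 + u x 1 * hj 1 + u x 2 * hj 2 + ρ x ^ (-γ) * h

theorem SteadyEuler.potential_equation
    {Ω : Set (Fin 3 → ℝ)} {x : Fin 3 → ℝ}
    (he : SteadyEuler γ Ω ρ p u (fun _ => 0) (fun _ => 0))
    (hx : x ∈ Ω) (hγ : 1 < γ)
    (hρ : DifferentiableAt ℝ ρ x) (hp : DifferentiableAt ℝ p x) (hu : DifferentiableAt ℝ u x)
    (hpos : 0 < ρ x) (hB : bernoulliFn γ ρ p u x = E₁) :
    (γ - 1) * (E₁ - (∑ i, u x i ^ 2) / 2) * ∑ i, pd i (fun y => u y i) x =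
      ∑ i, ∑ j, u x i * u x j * pd j (fun y => u y i) x := by
  have hc : (γ - 1) * (E₁ - (∑ i, u x i ^ 2) / 2) = γ * p x / ρ x := by
    have : γ - 1 ≠ 0 := (sub_pos.2 hγ).ne'
    have h0 := hpos.ne'
    rw [← hB, bernoulliFn]
    field_simp
    ring
  rw [hc]
  have h1 := he.mass hx hρ hu
  have h2 := fun i => he.momentum hx hρ hu i
  have h3 := he.pressure_transport hx hγ hρ hp hu hpos
  have h0 := hpos.ne'
  have h20 := h2 0
  have h21 := h2 1
  have h22 := h2 2
  simp only [Fin.sum_univ_three] at h1 h20 h21 h22 h3 ⊢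
  field_simp
  apply mul_left_cancel₀ h0
  linear_combination γ * p x * h1 - ρ x * (u x 0 * h20 + u x 1 * h21 + u x 2 * h22) + h3

theorem SteadyEuler.irrotational (hγ : 1 < γ) (hr : 0 < r₁)
    (hρ : ContDiffOn ℝ 1 ρ {x | r₀ < enorm3 x ∧ enorm3 x ≤ r₁})
    (hp : ContDiffOn ℝ 1 p {x | r₀ < enorm3 x ∧ enorm3 x ≤ r₁})
    (hu : ContDiffOn ℝ 1 u {x | r₀ < enorm3 x ∧ enorm3 x ≤ r₁})
    (hu2 : ContDiffOn ℝ 2 u {x | r₀ < enorm3 x ∧ enorm3 x < r₁})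
    (he : SteadyEuler γ {x | r₀ < enorm3 x ∧ enorm3 x < r₁} ρ p u (fun _ => 0) (fun _ => 0))
    (hpos : ∀ x, r₀ < enorm3 x → enorm3 x ≤ r₁ → 0 < ρ x ∧ 0 < ∑ i, u x i * x i)
    (hB : ∀ x, r₀ < enorm3 x → enorm3 x ≤ r₁ → bernoulliFn γ ρ p u x = E₁)
    (hA : ∀ x, r₀ < enorm3 x → enorm3 x ≤ r₁ → p x * ρ x ^ (-γ) = A₁)
    (hn : ∀ x, enorm3 x = r₁ → ∀ i j, u x i * x j = u x j * x i) (h01 : r₀ < r₁)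
    {x : Fin 3 → ℝ} (h0 : r₀ < enorm3 x) (h1 : enorm3 x < r₁) (i j : Fin 3) :
    pd i (fun y => u y j) x = pd j (fun y => u y i) x := by
  set O : Set (Fin 3 → ℝ) := {x | r₀ < enorm3 x ∧ enorm3 x < r₁} with hO
  set S : Set (Fin 3 → ℝ) := {x | r₀ < enorm3 x ∧ enorm3 x ≤ r₁} with hS
  have hOo : IsOpen O := isOpen_openShell r₀ r₁
  have hOS : O ⊆ S := fun x hx => ⟨hx.1, hx.2.le⟩
  set W : (Fin 3 → ℝ) → Fin 3 → ℝ := fun x => curlCLM (fderivWithin ℝ u S x) with hW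
  have hWc : ContinuousOn W S := continuous_curlCLM.comp_continuousOn
    (hu.continuousOn_fderivWithin (uniqueDiffOn_halfOpenShell r₀ r₁ hr) (by norm_num))
  have hWO : ∀ x ∈ O, W x = curlCLM (fderiv ℝ u x) := by
    intro x hx
    have : S ∈ nhds x := Filter.mem_of_superset (hOo.mem_nhds hx) hOS
    simp only [hW, fderivWithin_of_mem_nhds this]
  have hWev : ∀ x ∈ O, W =ᶠ[nhds x] fun y => curlCLM (fderiv ℝ u y) := by
    intro x hx
    filter_upwards [hOo.mem_nhds hx] with y hy using hWO y hy
  have hu2x : ∀ x ∈ O, ContDiffAt ℝ 2 u x := fun x hx => hu2.contDiffAt (hOo.mem_nhds hx)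
  have hux : ∀ x ∈ O, DifferentiableAt ℝ u x := fun x hx => hu.differentiableAt_openShell hx.1 hx.2
  have hρx : ∀ x ∈ O, DifferentiableAt ℝ ρ x := fun x hx => hρ.differentiableAt_openShell hx.1 hx.2
  have hpx : ∀ x ∈ O, DifferentiableAt ℝ p x := fun x hx => hp.differentiableAt_openShell hx.1 hx.2
  set lam : (Fin 3 → ℝ) → ℝ := fun x => (∑ k, W x k * x k) / ∑ k, u x k * x k with hlam
  have hWcurl : ∀ x ∈ O, W x 0 = pd 1 (fun y => u y 2) x - pd 2 (fun y => u y 1) x ∧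
      W x 1 = pd 2 (fun y => u y 0) x - pd 0 (fun y => u y 2) x ∧
      W x 2 = pd 0 (fun y => u y 1) x - pd 1 (fun y => u y 0) x := by
    intro x hx
    simp [hWO x hx, curlCLM, pd_apply (hux x hx)]
  have hWlam : ∀ x ∈ O, ∀ i, W x i = lam x * u x i := by
    intro x hx
    have hρp := (hpos x hx.1 hx.2.le).1
    have hcr := he.crocco hx hγ (hρx x hx) (hpx x hx) (hux x hx) hρp
      (fun j => pd_const_of_eventuallyEq j (c := E₁) (by
        filter_upwards [hOo.mem_nhds hx] with y hy using hB y hy.1 hy.2.le))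
      (fun j => by
        have h1 := pd_entropy (γ := γ) (hρx x hx) (hpx x hx) hρp j
        rw [pd_const_of_eventuallyEq j (c := A₁) (by
          filter_upwards [hOo.mem_nhds hx] with y hy using hA y hy.1 hy.2.le), mul_zero] at h1
        have h2 : ρ x ^ (-γ) ≠ 0 := (Real.rpow_pos_of_pos hρp _).ne'
        have h3 := (mul_eq_zero.1 h1.symm).resolve_left h2
        linarith)
    obtain ⟨w0, w1, w2⟩ := hWcurl x hx
    have c0 := hcr 0
    have c1 := hcr 1
    have c2 := hcr 2
    simp only [Fin.sum_univ_three] at c0 c1 c2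
    refine eq_smul_of_cross_eq_zero (hpos x hx.1 hx.2.le).2.ne' ?_ ?_ ?_
    · rw [w0, w1]
      linear_combination -c2
    · rw [w0, w2]
      linear_combination c1
    · rw [w1, w2]
      linear_combination -c0
  have hdW : ∀ x ∈ O, DifferentiableAt ℝ W x := by
    intro x hx
    have h2 : DifferentiableAt ℝ (fderiv ℝ u) x :=
      ((hu2x x hx).fderiv_right (m := 1) (by norm_num)).differentiableAt (by norm_num)
    have h3 : DifferentiableAt ℝ (fun y => curlCLM (fderiv ℝ u y)) x := by
      have hcomp : ∀ (v : Fin 3 → ℝ) (i : Fin 3), DifferentiableAt ℝ (fun y => fderiv ℝ u y v i) x :=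
        fun v i => differentiableAt_pi.1 (h2.clm_apply (differentiableAt_const v)) i
      refine differentiableAt_pi.2 fun i => ?_
      fin_cases i <;> simp [curlCLM] <;> exact (hcomp _ _).fun_sub (hcomp _ _)
    exact h3.congr_of_eventuallyEq (hWev x hx)
  have hdlam : ∀ x ∈ O, DifferentiableAt ℝ lam x := by
    intro x hx
    have h2 : ∀ i, DifferentiableAt ℝ (fun y => W y i) x := differentiableAt_pi.1 (hdW x hx)
    have h3 : ∀ i, DifferentiableAt ℝ (fun y => u y i) x := differentiableAt_pi.1 (hux x hx)
    have h4 : ∑ k, u x k * x k ≠ 0 := (hpos x hx.1 hx.2.le).2.ne'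
    simp only [hlam]
    fun_prop (disch := assumption)
  have hzero := eq_of_transport (f := fun x => lam x / ρ x) (c := 0) (u := u) (r₀ := r₀) (r₁ := r₁)
    (by
      have h2 : ∀ i, ContinuousOn (fun x => W x i) S := continuousOn_pi.1 hWc
      have h3 : ∀ i, ContinuousOn (fun x => u x i) S := continuousOn_pi.1 hu.continuousOn
      have h4 : ∀ i, ContinuousOn (fun x : Fin 3 → ℝ => x i) S :=
        fun i => (continuous_apply i).continuousOn
      refine ContinuousOn.div (ContinuousOn.div ?_ ?_ ?_) hρ.continuousOn ?_
      · exact continuousOn_finsetSum _ fun i _ => (h2 i).mul (h4 i)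
      · exact continuousOn_finsetSum _ fun i _ => (h3 i).mul (h4 i)
      · exact fun x hx => (hpos x hx.1 hx.2).2.ne'
      · exact fun x hx => (hpos x hx.1 hx.2).1.ne')
    (fun x h0 h1 => by
      simp only [div_eq_mul_inv (lam _)]
      exact (hdlam x ⟨h0, h1⟩).fun_mul ((hρx x ⟨h0, h1⟩).fun_inv (hpos x h0 h1.le).1.ne'))
    (fun x h0 h1 => by
      have hx : x ∈ O := ⟨h0, h1⟩
      refine transport_of_divergence_free (w := W) (hρx x hx) (hux x hx) (hdlam x hx)
        (hpos x h0 h1.le).1 (he.mass hx (hρx x hx) (hux x hx)) (fun i => ?_) ?_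
      · filter_upwards [hOo.mem_nhds hx] with y hy using hWlam y hy i
      · rw [← sum_pd_curlCLM (hu2x x hx)]
        refine Finset.sum_congr rfl fun i _ => pd_congr i ?_
        filter_upwards [hWev x hx] with y hy
        rw [hy])
    (fun x h0 h1 => (hpos x h0 h1.le).2)
    (fun x hx => by
      have hxS : x ∈ S := ⟨h01.trans_eq hx.symm, hx.le⟩
      have h2 := curlCLM_normal_eq_zero
        ((hu.differentiableOn (by norm_num)) x hxS).hasFDerivWithinAt hr
        (fun y hy => ⟨h01.trans_eq hy.symm, hy.le⟩) hx hn
      have h3 : ∑ k, W x k * x k = 0 := h2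
      simp only [hlam, h3, zero_div])
  have hx : x ∈ O := ⟨h0, h1⟩
  have hl : lam x = 0 := by
    have := hzero x h0 h1.le
    exact (div_eq_zero_iff.1 this).resolve_right (hpos x h0 h1.le).1.ne'
  have hW0 : ∀ i, W x i = 0 := fun i => by rw [hWlam x hx i, hl, zero_mul]
  obtain ⟨w0, w1, w2⟩ := hWcurl x hx
  rw [hW0] at w0 w1 w2
  have e0 := (sub_eq_zero.1 w0.symm)
  have e1 := (sub_eq_zero.1 w1.symm)
  have e2 := (sub_eq_zero.1 w2.symm)
  fin_cases i <;> fin_cases j <;>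
    first | rfl | exact e0 | exact e0.symm | exact e1 | exact e1.symm | exact e2 | exact e2.symm

end EulerFlow

theorem secondDeriv_nonpos_of_isLocalMax {g g' : ℝ → ℝ} {a x : ℝ} (hmax : IsLocalMax g x)
    (hg : ∀ᶠ t in nhds x, HasDerivAt g (g' t) t) (hg' : HasDerivAt g' a x) : a ≤ 0 := by
  by_contra! ha
  have h0 : g' x = 0 := hmax.hasDerivAt_eq_zero hg.self_of_nhds
  have hlt := hg'.eventually_lt_nhdsGT ha
  rw [h0] at hlt
  obtain ⟨δ, hδ, hball⟩ := Metric.eventually_nhds_iff.1 (hg.and hmax)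
  obtain ⟨η, hη, hpos⟩ := mem_nhdsGT_iff_exists_Ioo_subset.1 hlt
  set m := min (δ / 2) ((η - x) / 2) with hm
  have hη' : x < η := hη
  have hm0 : 0 < m := lt_min (by linarith) (by linarith)
  have hm1 : m ≤ δ / 2 := min_le_left _ _
  have hm2 : m ≤ (η - x) / 2 := min_le_right _ _
  have hnear : ∀ t ∈ Set.Icc x (x + m), dist t x < δ := by
    intro t ht
    rw [Real.dist_eq, abs_lt]
    constructor <;> linarith [ht.1, ht.2]
  have hmono : StrictMonoOn g (Set.Icc x (x + m)) := by
    refine strictMonoOn_of_deriv_pos (convex_Icc _ _) ?_ ?_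
    · exact fun t ht => (hball (hnear t ht)).1.continuousAt.continuousWithinAt
    · intro t ht
      rw [interior_Icc] at ht
      rw [(hball (hnear t ⟨ht.1.le, ht.2.le⟩)).1.deriv]
      exact hpos ⟨ht.1, by linarith [ht.2]⟩
  have h1 := hmono ⟨le_rfl, by linarith⟩ ⟨by linarith, le_rfl⟩ (by linarith : x < x + m)
  have h2 := (hball (hnear (x + m) ⟨by linarith, le_rfl⟩)).2
  linarith

theorem IsLocalMax.gradient_eq_zero {w : (Fin 3 → ℝ) → ℝ} {F x : Fin 3 → ℝ}
    (hmax : IsLocalMax w x) (hw : HasFDerivAt w (dot3 F) x) : F = 0 := by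
  have h := hmax.hasFDerivAt_eq_zero hw
  funext i
  have := congrArg (fun L : (Fin 3 → ℝ) →L[ℝ] ℝ => L (Pi.single i 1)) h
  simpa [dot3_apply, Pi.single_apply] using this

theorem hasDerivAt_add_smul_const (x v : Fin 3 → ℝ) (t : ℝ) :
    HasDerivAt (fun s : ℝ => x + s • v) v t := by
  simpa using ((hasDerivAt_id t).smul_const v).const_add x

theorem IsLocalMax.dot3_fderiv_gradient_nonpos {w : (Fin 3 → ℝ) → ℝ}
    {F : (Fin 3 → ℝ) → Fin 3 → ℝ} {L : (Fin 3 → ℝ) →L[ℝ] (Fin 3 → ℝ)} {x : Fin 3 → ℝ}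
    (hmax : IsLocalMax w x) (hw : ∀ᶠ y in nhds x, HasFDerivAt w (dot3 (F y)) y)
    (hF : HasFDerivAt F L x) (v : Fin 3 → ℝ) : dot3 (L v) v ≤ 0 := by
  have hl := hasDerivAt_add_smul_const x v
  have hc : Filter.Tendsto (fun s : ℝ => x + s • v) (nhds 0) (nhds x) := by
    simpa using (hl 0).continuousAt.tendsto
  refine secondDeriv_nonpos_of_isLocalMax (g := fun s : ℝ => w (x + s • v))
    (g' := fun s => dot3 (F (x + s • v)) v) (x := 0) ?_ ?_ ?_
  · have := hc.eventually hmax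
    simpa [IsLocalMax, IsMaxFilter] using this
  · filter_upwards [hc.eventually hw] with s hs
    exact hs.comp_hasDerivAt s (hl s)
  · have h1 : HasDerivAt (fun s : ℝ => F (x + s • v)) (L v) 0 :=
      hF.comp_hasDerivAt_of_eq 0 (hl 0) (by simp)
    have h2 := (dot3.flip v).hasFDerivAt.comp_hasDerivAt (0 : ℝ) h1
    exact h2

section Comparison

variable {γ E r₀ r₁ σ : ℝ} {u : (Fin 3 → ℝ) → Fin 3 → ℝ} {φ : (Fin 3 → ℝ) → ℝ} {V V' Φ : ℝ → ℝ}

theorem hasFDerivAt_potential_sub (h0 : 0 < r₀)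
    (hφ : ∀ x, r₀ < enorm3 x → enorm3 x < r₁ → HasFDerivAt φ (dot3 (u x)) x)
    (hΦ : ∀ r, r₀ < r → r < r₁ → HasDerivAt Φ (V r) r) {x : Fin 3 → ℝ} (hx0 : r₀ < enorm3 x)
    (hx1 : enorm3 x < r₁) :
    HasFDerivAt (fun y => σ * (φ y - Φ (enorm3 y)))
      (dot3 (σ • (u x - (V (enorm3 x) * (enorm3 x)⁻¹) • x))) x := by
  have h1 := (hΦ _ hx0 hx1).comp_hasFDerivAt x (hasFDerivAt_enorm3 (h0.trans hx0).ne')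
  refine (((hφ x hx0 hx1).sub h1).const_mul σ).congr_fderiv ?_
  simp only [map_smul, map_sub, smul_smul]

theorem not_isLocalMax_potential_sub (h0 : 0 < r₀)
    (hu : ∀ x, r₀ < enorm3 x → enorm3 x < r₁ → DifferentiableAt ℝ u x)
    (heq : ∀ x, r₀ < enorm3 x → enorm3 x < r₁ →
      (γ - 1) * (E - (∑ i, u x i ^ 2) / 2) * ∑ i, pd i (fun y => u y i) x =
        ∑ i, ∑ j, u x i * u x j * pd j (fun y => u y i) x)
    (hφ : ∀ x, r₀ < enorm3 x → enorm3 x < r₁ → HasFDerivAt φ (dot3 (u x)) x)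
    (hσ : σ ≠ 0)
    (hV : ∀ r, r₀ < r → r < r₁ → V r ^ 2 < (γ - 1) * (E - V r ^ 2 / 2) ∧ HasDerivAt V (V' r) r)
    (hstrict : ∀ r, r₀ < r → r < r₁ → σ * (((γ - 1) * (E - V r ^ 2 / 2) - V r ^ 2) * V' r +
      2 * ((γ - 1) * (E - V r ^ 2 / 2)) * V r / r) < 0)
    (hΦ : ∀ r, r₀ < r → r < r₁ → HasDerivAt Φ (V r) r) {x : Fin 3 → ℝ} (hx0 : r₀ < enorm3 x)
    (hx1 : enorm3 x < r₁) : ¬ IsLocalMax (fun y => σ * (φ y - Φ (enorm3 y))) x := by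
  intro hmax
  set F : (Fin 3 → ℝ) → Fin 3 → ℝ := fun y => σ • (u y - (V (enorm3 y) * (enorm3 y)⁻¹) • y) with hF
  have hw : ∀ᶠ y in nhds x, HasFDerivAt (fun y => σ * (φ y - Φ (enorm3 y))) (dot3 (F y)) y := by
    filter_upwards [(isOpen_openShell r₀ r₁).mem_nhds ⟨hx0, hx1⟩] with y hy
    exact hasFDerivAt_potential_sub h0 hφ hΦ hy.1 hy.2
  have hF0 : F x = 0 := hmax.gradient_eq_zero hw.self_of_nhds
  have hr : 0 < enorm3 x := h0.trans hx0
  obtain ⟨hVs, hVd⟩ := hV _ hx0 hx1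
  have hs := hstrict _ hx0 hx1
  have hpe := heq x hx0 hx1
  have hsq := enorm3_sq x
  set r := enorm3 x with hrdef
  have hg : HasDerivAt (fun s => V s * s⁻¹) (V' r * r⁻¹ - V r * (r⁻¹) ^ 2) r := by
    refine (hVd.mul (hasDerivAt_inv hr.ne')).congr_deriv ?_
    field_simp
    ring
  have hgx : HasFDerivAt (fun y => V (enorm3 y) * (enorm3 y)⁻¹)
      ((V' r * r⁻¹ - V r * (r⁻¹) ^ 2) • r⁻¹ • dot3 x) x :=
    HasDerivAt.comp_hasFDerivAt (h₂ := fun s => V s * s⁻¹) x hg (hasFDerivAt_enorm3 hr.ne')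
  have hFd := ((hu x hx0 hx1).hasFDerivAt.sub (hgx.smul (hasFDerivAt_id x))).const_smul σ
  have hD : ∀ v i, fderiv ℝ u x v i = ∑ j, v j * pd j (fun y => u y i) x := by
    intro v i
    rw [sum_mul_pd, (hasFDerivAt_pi'.1 (hu x hx0 hx1).hasFDerivAt i).fderiv]
    rfl
  have hsecond := fun v => hmax.dot3_fderiv_gradient_nonpos hw hFd v
  set a := V r * r⁻¹ with ha
  have hVa : V r = a * r := by rw [ha]; field_simp
  have hua : ∀ i, u x i = a * x i := by
    intro i
    have h1 := congrFun hF0 i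
    simp only [hF, Pi.smul_apply, Pi.sub_apply, smul_eq_mul, Pi.zero_apply] at h1
    have := (mul_eq_zero.1 h1).resolve_left hσ
    linarith
  set G := (V' r * r⁻¹ - V r * (r⁻¹) ^ 2) * r⁻¹ with hG
  have hGr : G * r ^ 2 = V' r - a := by
    rw [hG, hVa]
    field_simp
  have hN : 2 * ((γ - 1) * (E - V r ^ 2 / 2)) * V r / r =
      2 * ((γ - 1) * (E - V r ^ 2 / 2)) * a := by
    rw [ha]; field_simp
  rw [hN] at hs
  have hineq : ∀ v : Fin 3 → ℝ, σ * (∑ i, (∑ j, v j * pd j (fun y => u y i) x) * v i -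
      a * ∑ i, v i ^ 2 - G * (∑ i, x i * v i) ^ 2) ≤ 0 := by
    intro v
    refine le_of_eq_of_le ?_ (hsecond v)
    simp only [dot3_apply, Fin.sum_univ_three, add_apply, smul_apply, sub_apply, Pi.add_apply,
      Pi.sub_apply, ContinuousLinearMap.smulRight_apply, ContinuousLinearMap.id_apply,
      Pi.smul_apply, smul_eq_mul, hD, id, hG]
    ring
  have e0 := hineq ![1, 0, 0]
  have e1 := hineq ![0, 1, 0]
  have e2 := hineq ![0, 0, 1]
  have t0 := hineq ![0, x 2, -x 1]
  have t1 := hineq ![-x 2, 0, x 0]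
  have t2 := hineq ![x 1, -x 0, 0]
  have hV2 : V r ^ 2 = ∑ i, u x i ^ 2 := by
    rw [hVa, mul_pow, hsq]
    simp only [hua, Fin.sum_univ_three]
    ring
  rw [← hV2] at hpe
  set c := (γ - 1) * (E - V r ^ 2 / 2) with hc
  simp only [hua, Fin.sum_univ_three, Matrix.cons_val] at e0 e1 e2 t0 t1 t2 hpe hsq
  have hcV := sub_pos.2 hVs
  have he := mul_nonpos_of_nonneg_of_nonpos hcV.le (add_nonpos (add_nonpos e0 e1) e2)
  have ht := mul_nonpos_of_nonneg_of_nonpos (sq_nonneg a) (add_nonpos (add_nonpos t0 t1) t2)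
  have hfin := add_nonpos he ht
  rw [hVa] at hfin hs
  refine absurd hfin (not_le.2 ?_)
  refine (neg_pos.2 hs).trans_eq ?_
  clear_value a G c
  linear_combination (-σ) * hpe + σ * (c - (a * r) ^ 2) * hGr - σ * ((c - (a * r) ^ 2) * G +
    2 * a ^ 3 - a ^ 2 * (pd 0 (fun y => u y 0) x + pd 1 (fun y => u y 1) x +
      pd 2 (fun y => u y 2) x)) * hsq

/-- At a maximum over an exterior domain `r ≤ |y|` attained on the inner sphere the flow speed is
dominated by the radial profile. -/
theorem speed_le_of_isMaxOn (h0 : 0 < r₀)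
    (hφ : ∀ x, r₀ < enorm3 x → enorm3 x < r₁ → HasFDerivAt φ (dot3 (u x)) x)
    (hσ : σ ≠ 0)
    (hΦ : ∀ r, r₀ < r → r < r₁ → HasDerivAt Φ (V r) r) {x : Fin 3 → ℝ} (hx0 : r₀ < enorm3 x)
    (hx1 : enorm3 x < r₁) (hux : 0 < ∑ i, u x i * x i)
    (hmax : ∀ y, enorm3 x ≤ enorm3 y → enorm3 y ≤ r₁ →
      σ * (φ y - Φ (enorm3 y)) ≤ σ * (φ x - Φ (enorm3 x))) :
    σ * (enorm3 (u x) - V (enorm3 x)) ≤ 0 := by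
  have hd := hasFDerivAt_potential_sub (σ := σ) h0 hφ hΦ hx0 hx1
  have hr : 0 < enorm3 x := h0.trans hx0
  set a := V (enorm3 x) * (enorm3 x)⁻¹ with ha
  set F := σ • (u x - a • x) with hF
  have hsq := enorm3_sq x
  have hdir : ∀ v : Fin 3 → ℝ, 0 ≤ dot3 x v → dot3 F v ≤ 0 := by
    intro v hv
    by_contra! hpos
    have hl := hasDerivAt_add_smul_const x v
    have hder : HasDerivAt (fun s : ℝ => σ * (φ (x + s • v) - Φ (enorm3 (x + s • v)))) (dot3 F v)
        0 := hd.comp_hasDerivAt_of_eq 0 (hl 0) (by simp)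
    have hlt := hder.eventually_lt_nhdsGT hpos
    have hline : Filter.Tendsto (fun s : ℝ => x + s • v) (nhds 0) (nhds x) := by
      simpa using (hl 0).continuousAt.tendsto
    have hlim : Filter.Tendsto (fun s : ℝ => enorm3 (x + s • v)) (nhds 0) (nhds (enorm3 x)) :=
      (continuous_enorm3.tendsto x).comp hline
    have hnear := (hlim.eventually (gt_mem_nhds hx1)).filter_mono
      (nhdsWithin_le_nhds (s := Set.Ioi (0 : ℝ)))
    obtain ⟨s, ⟨hs1, hs2⟩, hs0⟩ := ((hlt.and hnear).and self_mem_nhdsWithin).exists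
    have hs0' : 0 < s := hs0
    have hge : enorm3 x ≤ enorm3 (x + s • v) := by
      refine (sq_le_sq₀ hr.le (enorm3_nonneg _)).1 ?_
      rw [enorm3_sq, enorm3_sq]
      simp only [dot3_apply, Fin.sum_univ_three, Pi.add_apply, Pi.smul_apply, smul_eq_mul] at hv ⊢
      nlinarith [mul_nonneg hs0'.le hv, sq_nonneg (s * v 0), sq_nonneg (s * v 1),
        sq_nonneg (s * v 2)]
    have := hmax _ hge hs2.le
    simp only [zero_smul, add_zero] at hs1
    linarith
  have htan : ∀ v : Fin 3 → ℝ, dot3 x v = 0 → dot3 F v = 0 := by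
    intro v hv
    refine le_antisymm (hdir v hv.ge) ?_
    have := hdir (-v) (by rw [map_neg, hv, neg_zero])
    rw [map_neg] at this
    linarith
  have hrad : dot3 F x ≤ 0 := hdir x (by
    rw [dot3_apply]
    exact Finset.sum_nonneg fun i _ => mul_self_nonneg (x i))
  have ht := htan ((enorm3 x ^ 2) • u x - (∑ i, u x i * x i) • x) (by
    simp only [dot3_apply, Fin.sum_univ_three, Pi.sub_apply, Pi.smul_apply, smul_eq_mul, hsq]
    ring)
  have husq := enorm3_sq (u x)
  have hpar : enorm3 (u x) * enorm3 x = ∑ i, u x i * x i := by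
    refine (sq_eq_sq₀ (by have := enorm3_nonneg (u x); positivity) hux.le).1 ?_
    apply mul_left_cancel₀ hσ
    simp only [hF, map_smul, map_sub, smul_apply, sub_apply, dot3_apply, Fin.sum_univ_three,
      smul_eq_mul] at ht hsq husq ⊢
    rw [mul_pow, husq]
    linear_combination ht + σ * a * (x 0 * u x 0 + x 1 * u x 1 + x 2 * u x 2) * hsq
  have hax : a * enorm3 x ^ 2 = V (enorm3 x) * enorm3 x := by
    rw [ha]
    field_simp
  have hval : dot3 F x = σ * (enorm3 (u x) - V (enorm3 x)) * enorm3 x := by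
    rw [sub_eq_add_neg, mul_assoc, add_mul, hpar, neg_mul, ← hax, hsq]
    simp only [hF, map_smul, map_sub, smul_apply, sub_apply, dot3_apply, Fin.sum_univ_three,
      smul_eq_mul]
    ring
  rw [hval] at hrad
  exact nonpos_of_mul_nonpos_left hrad hr

/-- Comparison of a subsonic-side potential with a strict radial super- or subsolution. -/
theorem potential_comparison (h0 : 0 < r₀)
    (huc : ContinuousOn u {x | r₀ ≤ enorm3 x ∧ enorm3 x ≤ r₁})
    (hu : ∀ x, r₀ < enorm3 x → enorm3 x < r₁ → DifferentiableAt ℝ u x)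
    (hux : ∀ x, r₀ < enorm3 x → enorm3 x < r₁ → 0 < ∑ i, u x i * x i)
    (heq : ∀ x, r₀ < enorm3 x → enorm3 x < r₁ →
      (γ - 1) * (E - (∑ i, u x i ^ 2) / 2) * ∑ i, pd i (fun y => u y i) x =
        ∑ i, ∑ j, u x i * u x j * pd j (fun y => u y i) x)
    (hφ : ∀ x, r₀ < enorm3 x → enorm3 x < r₁ → HasFDerivAt φ (dot3 (u x)) x)
    (hφc : ContinuousOn φ {x | r₀ < enorm3 x ∧ enorm3 x ≤ r₁})
    (hφb : ∀ x, enorm3 x = r₁ → φ x = 0)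
    (hσ : σ ≠ 0)
    (hV : ∀ r ∈ Set.Icc r₀ r₁, V r ^ 2 < (γ - 1) * (E - V r ^ 2 / 2) ∧ HasDerivAt V (V' r) r)
    (hstrict : ∀ r ∈ Set.Icc r₀ r₁, σ * (((γ - 1) * (E - V r ^ 2 / 2) - V r ^ 2) * V' r +
      2 * ((γ - 1) * (E - V r ^ 2 / 2)) * V r / r) < 0)
    (hin : ∀ x, enorm3 x = r₀ → 0 < σ * (enorm3 (u x) - V r₀))
    (hΦ : ∀ r, r₀ < r → r < r₁ → HasDerivAt Φ (V r) r) (hΦc : ContinuousOn Φ (Set.Icc r₀ r₁))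
    (hΦb : Φ r₁ = 0) {x : Fin 3 → ℝ} (hx0 : r₀ < enorm3 x) (hx1 : enorm3 x ≤ r₁) :
    σ * (φ x - Φ (enorm3 x)) ≤ 0 := by
  rcases hx1.eq_or_lt with hx1 | hx1
  · rw [hx1, hφb x hx1, hΦb]
    simp
  obtain ⟨r', hr'0, hr'x, hr'⟩ : ∃ r', r₀ < r' ∧ r' ≤ enorm3 x ∧
      ∀ y, enorm3 y = r' → 0 < σ * (enorm3 (u y) - V (enorm3 y)) := by
    set C : Set (Fin 3 → ℝ) := {x | r₀ ≤ enorm3 x ∧ enorm3 x ≤ r₁} with hC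
    have hCc : IsCompact C := isCompact_shell r₀ r₁
    have hcont : ContinuousOn (fun y => σ * (enorm3 (u y) - V (enorm3 y))) C := by
      have hVc : ContinuousOn V (Set.Icc r₀ r₁) :=
        fun r hr => (hV r hr).2.continuousAt.continuousWithinAt
      exact continuousOn_const.mul ((continuous_enorm3.comp_continuousOn huc).sub
        (hVc.comp continuous_enorm3.continuousOn fun y hy => hy))
    set T : Set (Fin 3 → ℝ) := C ∩ (fun y => σ * (enorm3 (u y) - V (enorm3 y))) ⁻¹' Set.Iic 0 with hT
    have hTc : IsCompact T := hCc.of_isClosed_subset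
      (hcont.preimage_isClosed_of_isClosed hCc.isClosed isClosed_Iic) Set.inter_subset_left
    have hpos : ∀ r', r₀ ≤ r' → r' ≤ r₁ → (∀ y ∈ T, r' < enorm3 y) →
        ∀ y, enorm3 y = r' → 0 < σ * (enorm3 (u y) - V (enorm3 y)) := by
      intro r' h1 h2 h y hy
      by_contra! hle
      have := h y ⟨⟨hy ▸ h1, hy ▸ h2⟩, hle⟩
      exact this.ne' hy
    rcases T.eq_empty_or_nonempty with hTe | hTn
    · refine ⟨enorm3 x, hx0, le_rfl, hpos _ hx0.le hx1.le ?_⟩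
      simp [hTe]
    · obtain ⟨z, hzT, hz⟩ := hTc.exists_isMinOn hTn continuous_enorm3.continuousOn
      have hz0 : r₀ < enorm3 z := by
        refine lt_of_le_of_ne hzT.1.1 fun h => ?_
        have h1 := hin z h.symm
        have h2 : σ * (enorm3 (u z) - V (enorm3 z)) ≤ 0 := hzT.2
        rw [← h] at h2
        linarith
      have hm : r₀ < min (enorm3 x) ((r₀ + enorm3 z) / 2) := lt_min hx0 (by linarith)
      refine ⟨min (enorm3 x) ((r₀ + enorm3 z) / 2), hm, min_le_left _ _,
        hpos _ hm.le ((min_le_left _ _).trans hx1.le) fun y hy => ?_⟩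
      have h1 : enorm3 z ≤ enorm3 y := hz hy
      have h2 := min_le_right (enorm3 x) ((r₀ + enorm3 z) / 2)
      linarith
  set D : Set (Fin 3 → ℝ) := {y | r' ≤ enorm3 y ∧ enorm3 y ≤ r₁} with hD
  have hDc : IsCompact D := isCompact_shell r' r₁
  have hxD : x ∈ D := ⟨hr'x, hx1.le⟩
  have hwc : ContinuousOn (fun y => σ * (φ y - Φ (enorm3 y))) D := by
    refine continuousOn_const.mul (ContinuousOn.sub ?_ ?_)
    · exact hφc.mono fun y hy => ⟨hr'0.trans_le hy.1, hy.2⟩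
    · exact hΦc.comp continuous_enorm3.continuousOn fun y hy => ⟨hr'0.le.trans hy.1, hy.2⟩
  obtain ⟨z, hzD, hz⟩ := hDc.exists_isMaxOn ⟨x, hxD⟩ hwc
  have hz0 : r₀ < enorm3 z := hr'0.trans_le hzD.1
  rcases hzD.2.eq_or_lt with hz1 | hz1
  · have h1 : σ * (φ x - Φ (enorm3 x)) ≤ σ * (φ z - Φ (enorm3 z)) := hz hxD
    rwa [hz1, hφb z hz1, hΦb, sub_self, mul_zero] at h1
  rcases hzD.1.eq_or_lt with hzr | hzr
  · have h1 := speed_le_of_isMaxOn h0 hφ hσ hΦ hz0 hz1 (hux z hz0 hz1)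
      (fun y hy0 hy1 => hz ⟨hzr.le.trans hy0, hy1⟩)
    exact absurd h1 (not_le.2 (hr' z hzr.symm))
  · refine absurd (hz.isLocalMax (Filter.mem_of_superset
      ((isOpen_openShell r' r₁).mem_nhds ⟨hzr, hz1⟩) fun y hy => ⟨hy.1.le, hy.2.le⟩)) ?_
    exact not_isLocalMax_potential_sub h0 hu heq hφ hσ (fun r h1 h2 => hV r ⟨h1.le, h2.le⟩)
      (fun r h1 h2 => hstrict r ⟨h1.le, h2.le⟩) hΦ hz0 hz1

end Comparison

theorem eq_radial_profile_of_potential {γ E q₀ r₀ r₁ : ℝ} {u : (Fin 3 → ℝ) → Fin 3 → ℝ}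
    {φ : (Fin 3 → ℝ) → ℝ} (hγ : 1 < γ) (hE : 0 < E) (h0 : 0 < r₀)
    (h01 : r₀ < r₁) (hq : 0 < q₀) (hsub : q₀ ^ 2 < (γ - 1) * (E - q₀ ^ 2 / 2))
    (huc : ContinuousOn u {x | r₀ ≤ enorm3 x ∧ enorm3 x ≤ r₁})
    (hu : ∀ x, r₀ < enorm3 x → enorm3 x < r₁ → DifferentiableAt ℝ u x)
    (hux : ∀ x, r₀ < enorm3 x → enorm3 x < r₁ → 0 < ∑ i, u x i * x i)
    (heq : ∀ x, r₀ < enorm3 x → enorm3 x < r₁ →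
      (γ - 1) * (E - (∑ i, u x i ^ 2) / 2) * ∑ i, pd i (fun y => u y i) x =
        ∑ i, ∑ j, u x i * u x j * pd j (fun y => u y i) x)
    (hφ : ∀ x, r₀ < enorm3 x → enorm3 x < r₁ → HasFDerivAt φ (dot3 (u x)) x)
    (hφc : ContinuousOn φ {x | r₀ < enorm3 x ∧ enorm3 x ≤ r₁})
    (hφb : ∀ x, enorm3 x = r₁ → φ x = 0)
    (hin : ∀ x, enorm3 x = r₀ → enorm3 (u x) = q₀) :
    ∃ V : ℝ → ℝ,
      (∀ r ∈ Set.Icc r₀ r₁, 0 < V r ∧ V r ^ 2 < (γ - 1) * (E - V r ^ 2 / 2) ∧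
        HasDerivAt V (-(2 * ((γ - 1) * (E - V r ^ 2 / 2)) * V r) /
          (r * ((γ - 1) * (E - V r ^ 2 / 2) - V r ^ 2))) r) ∧
      ∀ x, r₀ < enorm3 x → enorm3 x < r₁ → u x = (V (enorm3 x) * (enorm3 x)⁻¹) • x := by
  obtain ⟨V, K, ε₀, hε₀, hV0, hV, hVpos, hVneg, hVlim⟩ :=
    exists_radial_profiles hγ hE h0 h01 hq hsub
  have hzero : |(0 : ℝ)| < ε₀ := by simpa using hε₀
  have hVc : ∀ ε, |ε| < ε₀ → ContinuousOn (V ε) (Set.Icc r₀ r₁) := fun ε hε r hr =>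
    (hV ε hε r hr).2.2.2.continuousAt.continuousWithinAt
  have hsubset : ∀ r, r₀ ≤ r → r ≤ r₁ → Set.uIcc r₁ r ⊆ Set.Icc r₀ r₁ := by
    intro r h1 h2
    rw [Set.uIcc_of_ge h2]
    exact Set.Icc_subset_Icc_left h1
  have h_integrable : ∀ ε, |ε| < ε₀ → ∀ r, r₀ ≤ r → r ≤ r₁ →
      IntervalIntegrable (V ε) MeasureTheory.volume r₁ r := fun ε hε r h1 h2 =>
    ((hVc ε hε).mono (hsubset r h1 h2)).intervalIntegrable
  set Φ : ℝ → ℝ → ℝ := fun ε r => ∫ s in r₁..r, V ε s with hΦdef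
  have hΦ : ∀ ε, |ε| < ε₀ → ∀ r, r₀ < r → r < r₁ → HasDerivAt (Φ ε) (V ε r) r := by
    intro ε hε r h1 h2
    refine intervalIntegral.integral_hasDerivAt_right (h_integrable ε hε r h1.le h2.le) ?_
      (hV ε hε r ⟨h1.le, h2.le⟩).2.2.2.continuousAt
    exact ((hVc ε hε).mono Set.Ioo_subset_Icc_self).stronglyMeasurableAtFilter isOpen_Ioo r ⟨h1, h2⟩
  have hΦc : ∀ ε, |ε| < ε₀ → ContinuousOn (Φ ε) (Set.Icc r₀ r₁) := by
    intro ε hε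
    have := intervalIntegral.continuousOn_primitive_interval' (h_integrable ε hε r₀ le_rfl h01.le)
      Set.left_mem_uIcc
    rwa [Set.uIcc_of_ge h01.le] at this
  have hΦb : ∀ ε, Φ ε r₁ = 0 := fun ε => intervalIntegral.integral_same
  have hcomp : ∀ ε, |ε| < ε₀ → ε ≠ 0 → ∀ x, r₀ < enorm3 x → enorm3 x ≤ r₁ →
      -ε * (φ x - Φ ε (enorm3 x)) ≤ 0 := by
    intro ε hε hne x hx0 hx1
    refine potential_comparison (σ := -ε) h0 huc hu hux heq hφ hφc hφb (neg_ne_zero.2 hne)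
      (fun r hr => ⟨(hV ε hε r hr).2.2.1, (hV ε hε r hr).2.2.2⟩) ?_ ?_ (hΦ ε hε) (hΦc ε hε)
      (hΦb ε) hx0 hx1
    · intro r hr
      obtain ⟨h1, h2, h3, -⟩ := hV ε hε r hr
      have hr0 : 0 < r := h0.trans_le hr.1
      have h4 := sub_pos.2 h3
      set c := (γ - 1) * (E - V ε r ^ 2 / 2) with hc
      have hcpos : 0 < c := (sq_nonneg (V ε r)).trans_lt h3
      have h5 := h4.ne'
      have : -ε * ((c - V ε r ^ 2) * (V ε r * c * (ε / K ε r - 2 / r) / (c - V ε r ^ 2)) +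
          2 * c * V ε r / r) = -(ε ^ 2 * V ε r * c / K ε r) := by
        field_simp
        ring
      rw [this]
      have : 0 < ε ^ 2 := by positivity
      exact neg_neg_of_pos (by positivity)
    · intro x hx
      rw [hin x hx]
      rcases lt_or_gt_of_ne hne with h | h
      · nlinarith [hVneg ε hε h]
      · nlinarith [hVpos ε hε h]
  have hlim : ∀ r, r₀ ≤ r → r ≤ r₁ → Filter.Tendsto (fun ε => Φ ε r) (nhds 0) (nhds (Φ 0 r)) := by
    intro r h1 h2
    have hsmall : ∀ᶠ ε : ℝ in nhds 0, |ε| < ε₀ := by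
      have : Filter.Tendsto (fun ε : ℝ => |ε|) (nhds 0) (nhds |0|) := continuous_abs.tendsto 0
      exact this.eventually (gt_mem_nhds hzero)
    have hmem : ∀ s ∈ Set.uIoc r₁ r, s ∈ Set.Icc r₀ r₁ := fun s hs =>
      hsubset r h1 h2 (Set.uIoc_subset_uIcc hs)
    refine intervalIntegral.tendsto_integral_filter_of_dominated_convergence
      (fun _ => (γ - 1) * E + 1) ?_ ?_ intervalIntegrable_const ?_
    · filter_upwards [hsmall] with ε hε
      exact ((hVc ε hε).mono hmem).aestronglyMeasurable measurableSet_uIoc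
    · filter_upwards [hsmall] with ε hε
      refine Filter.Eventually.of_forall fun s hs => ?_
      obtain ⟨h3, -, h4, -⟩ := hV ε hε s (hmem s hs)
      rw [Real.norm_eq_abs, abs_of_pos h3]
      nlinarith [sq_nonneg (V ε s - 1), mul_nonneg (sub_pos.2 hγ).le (sq_nonneg (V ε s))]
    · exact Filter.Eventually.of_forall fun s hs => hVlim s (hmem s hs)
  have heqφ : ∀ x, r₀ < enorm3 x → enorm3 x < r₁ → φ x = Φ 0 (enorm3 x) := by
    intro x hx0 hx1
    have hl := hlim _ hx0.le hx1.le
    refine le_antisymm ?_ ?_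
    · refine ge_of_tendsto (hl.mono_left (nhdsWithin_le_nhds (s := Set.Iio 0))) ?_
      filter_upwards [Ioo_mem_nhdsLT (neg_lt_zero.2 hε₀)] with ε hε
      have := hcomp ε (by rw [abs_of_neg hε.2]; linarith [hε.1]) hε.2.ne x hx0 hx1.le
      have h1 : 0 < -ε := by linarith [hε.2]
      linarith [nonpos_of_mul_nonpos_right this h1]
    · refine le_of_tendsto (hl.mono_left (nhdsWithin_le_nhds (s := Set.Ioi 0))) ?_
      filter_upwards [Ioo_mem_nhdsGT hε₀] with ε hε
      have := hcomp ε (by rw [abs_of_pos hε.1]; exact hε.2) hε.1.ne' x hx0 hx1.le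
      rw [neg_mul, neg_nonpos] at this
      linarith [nonneg_of_mul_nonneg_right this hε.1]
  refine ⟨V 0, fun r hr => ?_, fun x hx0 hx1 => ?_⟩
  · obtain ⟨h1, h2, h3, h4⟩ := hV 0 hzero r hr
    refine ⟨h1, h3, h4.congr_deriv ?_⟩
    have hr0 : r ≠ 0 := (h0.trans_le hr.1).ne'
    have h5 := (sub_pos.2 h3).ne'
    rw [zero_div, zero_sub]
    generalize (γ - 1) * (E - V 0 r ^ 2 / 2) = c at h5
    field_simp
  · have hd := hasFDerivAt_potential_sub (σ := 1) h0 hφ (hΦ 0 hzero) hx0 hx1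
    have hmax : IsLocalMax (fun y => 1 * (φ y - Φ 0 (enorm3 y))) x := by
      filter_upwards [(isOpen_openShell r₀ r₁).mem_nhds ⟨hx0, hx1⟩] with y hy
      rw [heqφ y hy.1 hy.2, heqφ x hx0 hx1, sub_self, sub_self]
    have := hmax.gradient_eq_zero hd
    rw [one_smul] at this
    exact sub_eq_zero.1 this

theorem closedShell_subset_closure_openShell {r₀ r₁ : ℝ} (h0 : 0 < r₀) (h01 : r₀ < r₁) :
    {x | r₀ ≤ enorm3 x ∧ enorm3 x ≤ r₁} ⊆ closure {x | r₀ < enorm3 x ∧ enorm3 x < r₁} := by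
  rintro x ⟨hx0, hx1⟩
  have hN : 0 < enorm3 x := h0.trans_le hx0
  set m : ℝ := (r₀ + r₁) / 2 with hm
  have hc : Continuous fun s : ℝ => ((1 - s) + s * (m / enorm3 x)) • x := by fun_prop
  have hlim : Filter.Tendsto (fun s : ℝ => ((1 - s) + s * (m / enorm3 x)) • x)
      (nhdsWithin 0 (Set.Ioi 0)) (nhds x) := by
    have := (hc.tendsto 0).mono_left (nhdsWithin_le_nhds (s := Set.Ioi 0))
    simpa using this
  refine mem_closure_of_tendsto hlim ?_
  filter_upwards [Ioo_mem_nhdsGT (show (0 : ℝ) < 1 by norm_num)] with s hs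
  have hm0 : 0 < m := by rw [hm]; linarith
  have hnorm : enorm3 (((1 - s) + s * (m / enorm3 x)) • x) = (1 - s) * enorm3 x + s * m := by
    rw [enorm3_smul, abs_of_pos]
    · field_simp
    · have h1 := sub_pos.2 hs.2
      have h2 := hs.1
      positivity
  have h1 := hs.1
  have h2 := sub_pos.2 hs.2
  constructor
  · rw [hnorm]
    nlinarith [mul_le_mul_of_nonneg_left hx0 h2.le, mul_pos h1 (show 0 < m - r₀ by rw [hm]; linarith)]
  · rw [hnorm]
    nlinarith [mul_le_mul_of_nonneg_left hx1 h2.le, mul_pos h1 (show 0 < r₁ - m by rw [hm]; linarith)]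

theorem eqOn_closedShell {F : Type*} [TopologicalSpace F] [T2Space F] {r₀ r₁ : ℝ} (h0 : 0 < r₀)
    (h01 : r₀ < r₁) {f g : (Fin 3 → ℝ) → F}
    (hf : ContinuousOn f {x | r₀ ≤ enorm3 x ∧ enorm3 x ≤ r₁})
    (hg : ContinuousOn g {x | r₀ ≤ enorm3 x ∧ enorm3 x ≤ r₁})
    (h : ∀ x, r₀ < enorm3 x → enorm3 x < r₁ → f x = g x) :
    Set.EqOn f g {x | r₀ ≤ enorm3 x ∧ enorm3 x ≤ r₁} :=
  Set.EqOn.of_subset_closure (s := {x | r₀ < enorm3 x ∧ enorm3 x < r₁})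
    (fun x hx => h x hx.1 hx.2) hf hg (fun _ hx => ⟨hx.1.le, hx.2.le⟩)
    (closedShell_subset_closure_openShell h0 h01)

section GasState

variable {γ A E : ℝ}

theorem eq_mul_rpow_of_entropy {ρ p : ℝ} (hρ : 0 < ρ) (h : p * ρ ^ (-γ) = A) :
    p = A * ρ ^ γ := by
  rw [← h, mul_assoc, ← Real.rpow_add hρ]
  simp

theorem density_eq_of_bernoulli (hγ : 1 < γ) (hA : 0 < A) {ρ p Q : ℝ} (hρ : 0 < ρ)
    (hB : Q / 2 + γ * p / ((γ - 1) * ρ) = E) (hp : p = A * ρ ^ γ) :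
    ρ = ((γ - 1) / (γ * A) * (E - Q / 2)) ^ (1 / (γ - 1)) := by
  have h1 : 0 < γ - 1 := sub_pos.2 hγ
  have h2 : 0 < γ := by linarith
  have h3 : (γ - 1) / (γ * A) * (E - Q / 2) = ρ ^ (γ - 1) := by
    rw [← hB, hp, Real.rpow_sub_one hρ.ne']
    field_simp
    ring
  rw [h3, ← Real.rpow_mul hρ.le, mul_one_div_cancel h1.ne', Real.rpow_one]

theorem div_density_eq_of_entropy (hγ : 1 < γ) (hA : 0 < A) {ρ p : ℝ} (hρ : 0 < ρ)
    (hp : p = A * ρ ^ γ) : p / ρ = A ^ (1 / γ) * p ^ ((γ - 1) / γ) := by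
  have h2 : γ ≠ 0 := by linarith
  have h3 : A ^ (1 / γ) * A ^ ((γ - 1) / γ) = A := by
    rw [← Real.rpow_add hA, ← add_div, add_sub_cancel, div_self h2, Real.rpow_one]
  rw [hp, Real.mul_rpow hA.le (Real.rpow_nonneg hρ.le _), ← Real.rpow_mul hρ.le, ← mul_assoc, h3,
    mul_div_cancel₀ _ h2, Real.rpow_sub_one hρ.ne', mul_div_assoc]

theorem subsonic_inlet (hγ : 1 < γ) (hA : 0 < A) (hE : 0 < E) {p₀ : ℝ}
    (hsub : ((2 / γ) * ((γ - 1) / (γ + 1))) ^ (γ / (γ - 1)) * E ^ (γ / (γ - 1)) *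
      A ^ (-(1 / (γ - 1))) < p₀) :
    2 * (γ - 1) / (γ + 1) * E < γ * (A ^ (1 / γ) * p₀ ^ ((γ - 1) / γ)) := by
  have h1 : 0 < γ - 1 := sub_pos.2 hγ
  have h2 : 0 < γ := by linarith
  have hk : 0 < (2 / γ) * ((γ - 1) / (γ + 1)) := by positivity
  have h3 := Real.rpow_lt_rpow (by positivity) hsub (show 0 < (γ - 1) / γ by positivity)
  have e1 : γ / (γ - 1) * ((γ - 1) / γ) = 1 := by field_simp
  have e2 : -(1 / (γ - 1)) * ((γ - 1) / γ) = -(1 / γ) := by field_simp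
  rw [Real.mul_rpow (by positivity) (by positivity), Real.mul_rpow (by positivity) (by positivity),
    ← Real.rpow_mul hk.le, ← Real.rpow_mul hE.le, ← Real.rpow_mul hA.le, e1, e2, Real.rpow_one,
    Real.rpow_one, Real.rpow_neg hA.le] at h3
  have hA' : 0 < A ^ (1 / γ) := Real.rpow_pos_of_pos hA _
  have h4 := mul_lt_mul_of_pos_left h3 (mul_pos h2 hA')
  calc 2 * (γ - 1) / (γ + 1) * E
      = γ * A ^ (1 / γ) * (2 / γ * ((γ - 1) / (γ + 1)) * E * (A ^ (1 / γ))⁻¹) := by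
        generalize A ^ (1 / γ) = a at hA'
        field_simp
    _ < _ := h4
    _ = _ := by ring

theorem radialEuler_of_velocity (hγ : 1 < γ) (hA : 0 < A) {r₀ r₁ : ℝ} (h0 : 0 < r₀) {V : ℝ → ℝ}
    (hV : ∀ r ∈ Set.Icc r₀ r₁, 0 < V r ∧ V r ^ 2 < (γ - 1) * (E - V r ^ 2 / 2) ∧
      HasDerivAt V (-(2 * ((γ - 1) * (E - V r ^ 2 / 2)) * V r) /
        (r * ((γ - 1) * (E - V r ^ 2 / 2) - V r ^ 2))) r) :
    RadialEuler γ r₀ r₁ V (fun r => ((γ - 1) / (γ * A) * (E - V r ^ 2 / 2)) ^ (1 / (γ - 1)))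
        (fun r => A * (((γ - 1) / (γ * A) * (E - V r ^ 2 / 2)) ^ (1 / (γ - 1))) ^ γ) ∧
      ∀ r ∈ Set.Icc r₀ r₁, 0 < V r ∧ V r < Real.sqrt
        (γ * (A * (((γ - 1) / (γ * A) * (E - V r ^ 2 / 2)) ^ (1 / (γ - 1))) ^ γ) /
          ((γ - 1) / (γ * A) * (E - V r ^ 2 / 2)) ^ (1 / (γ - 1))) := by
  have h1 : 0 < γ - 1 := sub_pos.2 hγ
  have h2 : 0 < γ := by linarith
  have hk : ∀ r ∈ Set.Icc r₀ r₁, 0 < (γ - 1) / (γ * A) * (E - V r ^ 2 / 2) := fun r hr => by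
    have : 0 < E - V r ^ 2 / 2 :=
      (mul_pos_iff_of_pos_left h1).1 ((sq_nonneg _).trans_lt (hV r hr).2.1)
    positivity
  have hc : ∀ r ∈ Set.Icc r₀ r₁,
      γ * (A * (((γ - 1) / (γ * A) * (E - V r ^ 2 / 2)) ^ (1 / (γ - 1))) ^ γ) /
        ((γ - 1) / (γ * A) * (E - V r ^ 2 / 2)) ^ (1 / (γ - 1)) =
      (γ - 1) * (E - V r ^ 2 / 2) := fun r hr => by
    have hρ := Real.rpow_pos_of_pos (hk r hr) (1 / (γ - 1))
    have e : (((γ - 1) / (γ * A) * (E - V r ^ 2 / 2)) ^ (1 / (γ - 1))) ^ (γ - 1) =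
        (γ - 1) / (γ * A) * (E - V r ^ 2 / 2) := by
      rw [← Real.rpow_mul (hk r hr).le, one_div_mul_cancel h1.ne', Real.rpow_one]
    rw [mul_div_assoc, mul_div_assoc, ← Real.rpow_sub_one hρ.ne', e]
    field_simp
  refine ⟨fun r hr => ?_, fun r hr => ⟨(hV r hr).1, ?_⟩⟩
  · obtain ⟨hv, hs, hd⟩ := hV r hr
    have hr0 : 0 < r := h0.trans_le hr.1
    have hkr := hk r hr
    have hρ := Real.rpow_pos_of_pos hkr (1 / (γ - 1))
    have hcr := hc r hr
    have hne' : (γ - 1) * (E - V r ^ 2 / 2) - V r ^ 2 ≠ 0 := (sub_pos.2 hs).ne'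
    have hq : 0 < E - V r ^ 2 / 2 := (mul_pos_iff_of_pos_left h1).1 ((sq_nonneg _).trans_lt hs)
    have hkd := (((hd.fun_pow 2).div_const 2).const_sub E).const_mul ((γ - 1) / (γ * A))
    have hflip : V r ^ 2 - (γ - 1) * (E - V r ^ 2 / 2) =
        -((γ - 1) * (E - V r ^ 2 / 2) - V r ^ 2) := (neg_sub _ _).symm
    have hρd := (hkd.rpow_const (p := 1 / (γ - 1)) (Or.inl hkr.ne')).congr_deriv
      (g' := -(2 * ((γ - 1) / (γ * A) * (E - V r ^ 2 / 2)) ^ (1 / (γ - 1)) * V r ^ 2) /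
        (r * (V r ^ 2 - (γ - 1) * (E - V r ^ 2 / 2)))) (by
      rw [Real.rpow_sub_one hkr.ne', hflip]
      generalize ((γ - 1) / (γ * A) * (E - V r ^ 2 / 2)) ^ (1 / (γ - 1)) = R
      generalize (γ - 1) * (E - V r ^ 2 / 2) - V r ^ 2 = D at hne'
      generalize E - V r ^ 2 / 2 = Q at hq
      generalize γ - 1 = g at h1
      push_cast
      field_simp)
    have hpd := (hρd.rpow_const (p := γ) (Or.inl hρ.ne')).const_mul A
    simp only [hcr]
    refine ⟨(hd.congr_deriv ?_).hasDerivWithinAt, hρd.hasDerivWithinAt,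
      (hpd.congr_deriv ?_).hasDerivWithinAt⟩
    · rw [hflip]
      generalize (γ - 1) * (E - V r ^ 2 / 2) - V r ^ 2 = D
      rw [mul_neg, neg_div, div_neg]
    · rw [← hcr, mul_div_assoc γ, mul_div_assoc A, ← Real.rpow_sub_one hρ.ne']
      ring
  · rw [hc r hr]
    exact Real.lt_sqrt_of_sq_lt (hV r hr).2.1

end GasState

/-- Global uniqueness of spherically symmetric subsonic flows (Theorem 3.1):
any `C²` Euler flow in the spherical shell with spherically symmetric boundary data
(pressure at the entry; radial velocity, Bernoulli constant and entropy at the exit),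
positive density and positive radial mass flux, is itself spherically symmetric with
purely radial velocity, and it is the subsonic solution of the radial ODE system. -/
theorem symmetric_subsonic_flow_global_uniqueness
    (γ r₀ r₁ p₀ A₁ E₁ : ℝ)
    (hγ : 1 < γ) (h0 : 0 < r₀) (h01 : r₀ < r₁)
    (hp₀ : 0 < p₀) (hA₁ : 0 < A₁)
    (hE : E₁ > (γ / (γ - 1)) * A₁ ^ (1 / γ : ℝ) * p₀ ^ ((γ - 1) / γ : ℝ))
    (hsub : p₀ > ((2 / γ) * ((γ - 1) / (γ + 1))) ^ (γ / (γ - 1) : ℝ)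
      * E₁ ^ (γ / (γ - 1) : ℝ) * A₁ ^ (-(1 / (γ - 1)) : ℝ))
    (ρ p : (Fin 3 → ℝ) → ℝ) (u : (Fin 3 → ℝ) → Fin 3 → ℝ)
    (hρ2 : ContDiffOn ℝ 2 ρ {x | r₀ < enorm3 x ∧ enorm3 x < r₁})
    (hp2 : ContDiffOn ℝ 2 p {x | r₀ < enorm3 x ∧ enorm3 x < r₁})
    (hu2 : ContDiffOn ℝ 2 u {x | r₀ < enorm3 x ∧ enorm3 x < r₁})
    (hρ1 : ContDiffOn ℝ 1 ρ {x | r₀ ≤ enorm3 x ∧ enorm3 x ≤ r₁})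
    (hp1 : ContDiffOn ℝ 1 p {x | r₀ ≤ enorm3 x ∧ enorm3 x ≤ r₁})
    (hu1 : ContDiffOn ℝ 1 u {x | r₀ ≤ enorm3 x ∧ enorm3 x ≤ r₁})
    (heuler : SteadyEuler γ {x | r₀ < enorm3 x ∧ enorm3 x < r₁} ρ p u
      (fun _ => 0) (fun _ => 0))
    (hpos : ∀ x, r₀ ≤ enorm3 x → enorm3 x ≤ r₁ →
      0 < ρ x ∧ 0 < ∑ i, u x i * x i)
    (hbc0 : ∀ x, enorm3 x = r₀ → p x = p₀)
    (hbc1 : ∀ x, enorm3 x = r₁ →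
      (u x 1 * x 2 - u x 2 * x 1 = 0 ∧ u x 2 * x 0 - u x 0 * x 2 = 0 ∧
        u x 0 * x 1 - u x 1 * x 0 = 0) ∧
      (∑ i, (u x i) ^ 2) / 2 + γ * p x / ((γ - 1) * ρ x) = E₁ ∧
      p x * ρ x ^ (-γ : ℝ) = A₁) :
    ∃ uR ρR pR : ℝ → ℝ,
      (∀ x, r₀ ≤ enorm3 x → enorm3 x ≤ r₁ →
        (∀ i, u x i = uR (enorm3 x) * x i / enorm3 x) ∧
        ρ x = ρR (enorm3 x) ∧ p x = pR (enorm3 x)) ∧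
      RadialEuler γ r₀ r₁ uR ρR pR ∧
      (∀ t ∈ Set.Icc r₀ r₁, 0 < uR t ∧ uR t < Real.sqrt (γ * pR t / ρR t)) := by
  have hγ1 : 0 < γ - 1 := sub_pos.2 hγ
  have hγ0 : 0 < γ := by linarith
  have hE₁ : 0 < E₁ := lt_trans (by positivity) hE
  have hr₁ : 0 < r₁ := h0.trans h01
  have hsubset : {x | r₀ < enorm3 x ∧ enorm3 x ≤ r₁} ⊆ {x | r₀ ≤ enorm3 x ∧ enorm3 x ≤ r₁} :=
    fun _ hx => ⟨hx.1.le, hx.2⟩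
  have hρh := hρ1.mono hsubset
  have hph := hp1.mono hsubset
  have huh := hu1.mono hsubset
  have hposh : ∀ x, r₀ < enorm3 x → enorm3 x ≤ r₁ → 0 < ρ x ∧ 0 < ∑ i, u x i * x i :=
    fun x hx0 hx1 => hpos x hx0.le hx1
  have huc : ∀ i, ContinuousOn (fun x => u x i) {x | r₀ ≤ enorm3 x ∧ enorm3 x ≤ r₁} :=
    continuousOn_pi.1 hu1.continuousOn
  have hB := heuler.bernoulliFn_eq hγ hρh hph huh hposh fun x hx => (hbc1 x hx).2.1
  have hA := heuler.entropy_eq hγ hρh hph huh hposh fun x hx => (hbc1 x hx).2.2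
  have hn : ∀ x, enorm3 x = r₁ → ∀ i j, u x i * x j = u x j * x i := by
    intro x hx i j
    obtain ⟨⟨h1, h2, h3⟩, -⟩ := hbc1 x hx
    fin_cases i <;> fin_cases j <;> simp <;> linarith
  have hBc : ∀ x, r₀ ≤ enorm3 x → enorm3 x ≤ r₁ → bernoulliFn γ ρ p u x = E₁ := by
    refine fun x hx0 hx1 => eqOn_closedShell h0 h01 (f := bernoulliFn γ ρ p u) (g := fun _ => E₁)
      ?_ continuousOn_const (fun y hy0 hy1 => hB y hy0 hy1.le) ⟨hx0, hx1⟩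
    unfold bernoulliFn
    refine ((continuousOn_finsetSum _ fun i _ => (huc i).pow 2).div_const 2).add ?_
    refine (continuousOn_const.mul hp1.continuousOn).div
      (continuousOn_const.mul hρ1.continuousOn) ?_
    exact fun x hx => (mul_pos hγ1 (hpos x hx.1 hx.2).1).ne'
  have hAc : ∀ x, r₀ ≤ enorm3 x → enorm3 x ≤ r₁ → p x = A₁ * ρ x ^ γ := by
    refine fun x hx0 hx1 => eq_mul_rpow_of_entropy (hpos x hx0 hx1).1 ?_
    refine eqOn_closedShell h0 h01 (f := fun y => p y * ρ y ^ (-γ)) (g := fun _ => A₁)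
      ?_ continuousOn_const (fun y hy0 hy1 => hA y hy0 hy1.le) ⟨hx0, hx1⟩
    exact hp1.continuousOn.mul
      (hρ1.continuousOn.rpow_const fun x hx => Or.inl (hpos x hx.1 hx.2).1.ne')
  obtain ⟨M, hM⟩ : ∃ M, ∀ x ∈ {x | r₀ ≤ enorm3 x ∧ enorm3 x ≤ r₁}, ‖dot3 (u x)‖ ≤ M :=
    (isCompact_shell r₀ r₁).exists_bound_of_continuousOn
      (dot3.continuous.comp_continuousOn hu1.continuousOn)
  obtain ⟨φ, hφ, hφb, hφc⟩ := exists_potential h0 h01 huh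
    (fun x hx0 hx1 => hM x ⟨hx0.le, hx1⟩)
    (fun x hx0 hx1 i j => heuler.irrotational hγ hr₁ hρh hph huh hu2 hposh hB hA hn h01 hx0 hx1 i j)
    hn
  set K : ℝ := A₁ ^ (1 / γ) * p₀ ^ ((γ - 1) / γ) with hK
  have hsub' := subsonic_inlet hγ hA₁ hE₁ hsub
  rw [← hK] at hsub'
  have hEK : γ / (γ - 1) * K < E₁ := by
    rw [hK, ← mul_assoc]
    exact hE
  have hin : ∀ x, enorm3 x = r₀ → enorm3 (u x) = Real.sqrt (2 * (E₁ - γ / (γ - 1) * K)) := by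
    intro x hx
    have hx1 : enorm3 x ≤ r₁ := hx.le.trans h01.le
    have hρx := (hpos x hx.ge hx1).1
    have h1 := div_density_eq_of_entropy hγ hA₁ hρx (hAc x hx.ge hx1)
    have h2 := hBc x hx.ge hx1
    rw [hbc0 x hx, ← hK] at h1
    rw [bernoulliFn, hbc0 x hx, mul_div_mul_comm, h1] at h2
    rw [enorm3, ← h2]
    congr 1
    ring
  have hq0 : 0 < 2 * (E₁ - γ / (γ - 1) * K) := mul_pos two_pos (sub_pos.2 hEK)
  have hqs : Real.sqrt (2 * (E₁ - γ / (γ - 1) * K)) ^ 2 <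
      (γ - 1) * (E₁ - Real.sqrt (2 * (E₁ - γ / (γ - 1) * K)) ^ 2 / 2) := by
    rw [Real.sq_sqrt hq0.le]
    have h1 : (γ - 1) * (E₁ - 2 * (E₁ - γ / (γ - 1) * K) / 2) = γ * K := by
      field_simp
      ring
    have h2 : (γ - 1) * (γ / (γ - 1) * K) = γ * K := by field_simp
    rw [h1]
    rw [div_mul_eq_mul_div, div_lt_iff₀ (by linarith)] at hsub'
    nlinarith
  obtain ⟨V, hV, hVu⟩ := eq_radial_profile_of_potential hγ hE₁ h0 h01 (Real.sqrt_pos.2 hq0) hqs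
    hu1.continuousOn (fun x hx0 hx1 => huh.differentiableAt_openShell hx0 hx1)
    (fun x hx0 hx1 => (hposh x hx0 hx1.le).2)
    (fun x hx0 hx1 => heuler.potential_equation ⟨hx0, hx1⟩ hγ
      (hρh.differentiableAt_openShell hx0 hx1) (hph.differentiableAt_openShell hx0 hx1)
      (huh.differentiableAt_openShell hx0 hx1) (hposh x hx0 hx1.le).1 (hB x hx0 hx1.le))
    (fun x hx0 hx1 => hφ x hx0 hx1) hφc hφb hin
  have hVx : ∀ x, r₀ ≤ enorm3 x → enorm3 x ≤ r₁ →
      u x = (V (enorm3 x) * (enorm3 x)⁻¹) • x := by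
    refine fun x hx0 hx1 => eqOn_closedShell h0 h01 hu1.continuousOn
      (g := fun x => (V (enorm3 x) * (enorm3 x)⁻¹) • x) ?_ hVu ⟨hx0, hx1⟩
    have hVc : ContinuousOn V (Set.Icc r₀ r₁) := fun r hr =>
      (hV r hr).2.2.continuousAt.continuousWithinAt
    refine ((hVc.comp continuous_enorm3.continuousOn fun x hx => hx).mul
      (continuous_enorm3.continuousOn.inv₀ fun x hx => (h0.trans_le hx.1).ne')).smul continuousOn_id
  obtain ⟨hode, hss⟩ := radialEuler_of_velocity hγ hA₁ h0 hV
  refine ⟨V, _, _, fun x hx0 hx1 => ?_, hode, hss⟩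
  have hx : 0 < enorm3 x := h0.trans_le hx0
  have hspeed : ∑ i, u x i ^ 2 = V (enorm3 x) ^ 2 := by
    rw [← enorm3_sq, hVx x hx0 hx1, enorm3_smul, mul_pow, sq_abs, ← mul_pow,
      inv_mul_cancel_right₀ hx.ne']
  have hρx : ρ x = ((γ - 1) / (γ * A₁) * (E₁ - V (enorm3 x) ^ 2 / 2)) ^ (1 / (γ - 1)) := by
    rw [← hspeed]
    exact density_eq_of_bernoulli hγ hA₁ (hpos x hx0 hx1).1 (hBc x hx0 hx1) (hAc x hx0 hx1)
  refine ⟨fun i => ?_, hρx, ?_⟩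
  · rw [hVx x hx0 hx1, Pi.smul_apply, smul_eq_mul]
    ring
  · rw [hAc x hx0 hx1, ← hρx]
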